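/- Let M be a σ-compact, non-compact, connected 2-manifold (possibly with boundary). If M contains two disjoint embedded Möbius bands (equivalently, M contains a compact subsurface homeomorphic to the Klein bottle with an open disk removed), then the mapping class group 𝓜_c(M) = 𝓗_c(M)/𝓗₀(M) contains an element of infinite order. -/

import Mathlib

noncomputable section

open scoped Pointwise

/-- The Whitney topology on the homeomorphism group of a space `M`:
it is generated by the sets `{f | graph f ⊆ U}` where `U` runs over the open subsets
of `M × M`. -/
def whitneyTopology (M : Type*) [TopologicalSpace M] : TopologicalSpace (M ≃ₜ M) :=
  TopologicalSpace.generateFrom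
    {S : Set (M ≃ₜ M) | ∃ U : Set (M × M), IsOpen U ∧ S = {f : M ≃ₜ M | ∀ x : M, (x, f x) ∈ U}}

/-- We endow the homeomorphism group `𝓗(M)` with the Whitney topology. -/
instance (M : Type*) [TopologicalSpace M] : TopologicalSpace (M ≃ₜ M) := whitneyTopology M

/-- `𝓗_c(M)`: the set of compactly supported homeomorphisms of `M`. -/
def Hc (M : Type*) [TopologicalSpace M] : Set (M ≃ₜ M) :=
  {f : M ≃ₜ M | IsCompact (closure {x : M | f x ≠ x})}

/-- `𝓗₀(M)`: the identity component of the homeomorphism group of `M` with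
the Whitney topology. -/
def H0 (M : Type*) [TopologicalSpace M] : Set (M ≃ₜ M) :=
  connectedComponent (Homeomorph.refl M)

/-- The `n`-th power (iterate) of a self-homeomorphism. -/
def hpow {M : Type*} [TopologicalSpace M] (h : M ≃ₜ M) : ℕ → (M ≃ₜ M)
  | 0 => Homeomorph.refl M
  | n + 1 => (hpow h n).trans h

/-- The gluing relation for the Möbius band: `(0, t) ∼ (1, 1 - t)`. -/
def mobiusRel (p q : unitInterval × unitInterval) : Prop :=
  p.1 = 0 ∧ q.1 = 1 ∧ (q.2 : ℝ) = 1 - (p.2 : ℝ)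

/-- The Möbius band: the quotient of `[0,1] × [0,1]` identifying `(0,t)` with `(1, 1-t)`. -/
def MobiusBand : Type := Quot mobiusRel

instance : TopologicalSpace MobiusBand :=
  inferInstanceAs (TopologicalSpace (Quot mobiusRel))

/-- The boundary circle of the Möbius band: the image of `[0,1] × {0,1}`. -/
def mobiusBoundary : Set MobiusBand :=
  Quot.mk _ '' {p : unitInterval × unitInterval | p.2 = 0 ∨ p.2 = 1}

namespace MobiusMCG

section

open Complex Set Topology Filter Metric

theorem exists_continuous_log {X : Type*} [TopologicalSpace X] [SimplyConnectedSpace X]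
    [LocallyPathConnectedSpace X] {u : X → ℂ} (hu : Continuous u) (h0 : ∀ x, u x ≠ 0) :
    ∃ L : X → ℂ, Continuous L ∧ ∀ x, exp (L x) = u x := by
  obtain ⟨x0⟩ : Nonempty X := inferInstance
  obtain ⟨F, ⟨-, hF⟩, -⟩ := Complex.isCoveringMapOn_exp.existsUnique_continuousMap_lifts
    (⟨u, hu⟩ : C(X, ℂ)) (a₀ := x0) (e₀ := log (u x0)) (by simp [exp_log (h0 x0)])
      (by simpa using h0)
  exact ⟨F, F.continuous, fun x => congrFun hF x⟩

/-- A continuous function on a preconnected set with constant exponential is constant. -/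
theorem eq_of_exp_eq_on {X : Type*} [TopologicalSpace X] {s : Set X} (hs : IsPreconnected s)
    {L : X → ℂ} (hL : ContinuousOn L s) {c : ℂ} (h : ∀ x ∈ s, exp (L x) = c) {x y : X}
    (hx : x ∈ s) (hy : y ∈ s) : L x = L y :=
  isCoveringMap_exp.constOn_of_comp hs hL
    (fun a ha b hb => Subtype.ext (by simp [h a ha, h b hb])) hx hy

theorem eq_of_exp_eq {X : Type*} [TopologicalSpace X] [PreconnectedSpace X]
    {L : X → ℂ} (hL : Continuous L) {c : ℂ} (h : ∀ x, exp (L x) = c) (x y : X) : L x = L y :=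
  eq_of_exp_eq_on isPreconnected_univ hL.continuousOn (fun x _ => h x) (mem_univ x) (mem_univ y)

/-- The boundary loop of an injective image of the disc has no logarithm about the image of the
centre. -/
theorem not_exists_log_sphere {F : ℂ → ℂ} (hc : ContinuousOn F (closedBall 0 1))
    (hi : InjOn F (closedBall 0 1)) {L : ℝ → ℂ} (hL : Continuous L)
    (hper : ∀ θ, L (θ + 2 * Real.pi) = L θ)
    (hexp : ∀ θ : ℝ, exp (L θ) = F (exp (θ * I)) - F 0) : False := by
  let k : ℝ → ℝ := fun t => max 0 (min t 1)
  have hk0 : ∀ t, 0 ≤ k t := fun t => le_max_left _ _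
  have hk1 : ∀ t, k t ≤ 1 := fun t => max_le zero_le_one (min_le_right _ _)
  have hkc : Continuous k := by fun_prop
  have hne : ∀ t, (1 + k t : ℂ) ≠ 0 := fun t => by
    have : (1 + k t : ℝ) ≠ 0 := by linarith [hk0 t]
    exact_mod_cast this
  have hnorm : ∀ t, ‖(1 + k t : ℂ)‖ = 1 + k t := fun t => by
    rw [← ofReal_one, ← ofReal_add, norm_real, Real.norm_of_nonneg (by linarith [hk0 t])]
  let a : ℝ × ℝ → ℂ := fun p => exp (p.1 * I) / (1 + k p.2)
  let b : ℝ × ℝ → ℂ := fun p => -(k p.2 * exp (p.1 * I)) / (1 + k p.2)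
  have hac : Continuous a := by
    refine Continuous.div (by fun_prop) ?_ (fun p => hne _)
    fun_prop
  have hbc : Continuous b := by
    refine Continuous.div (by fun_prop) ?_ (fun p => hne _)
    fun_prop
  have ham : ∀ p, a p ∈ closedBall (0 : ℂ) 1 := fun p => by
    simp only [a, mem_closedBall_zero_iff, norm_div, norm_exp_ofReal_mul_I, hnorm]
    rw [div_le_one (by linarith [hk0 p.2])]
    linarith [hk0 p.2]
  have hbm : ∀ p, b p ∈ closedBall (0 : ℂ) 1 := fun p => by
    simp only [b, mem_closedBall_zero_iff, norm_div, norm_neg, norm_mul, norm_exp_ofReal_mul_I,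
      hnorm, norm_real, Real.norm_of_nonneg (hk0 p.2)]
    rw [div_le_one (by linarith [hk0 p.2])]
    linarith [hk0 p.2]
  have hab : ∀ p, a p ≠ b p := fun p h => by
    have h1 : a p - b p = exp (p.1 * I) := by
      simp only [a, b]
      field_simp [hne p.2]
      ring
    rw [h, sub_self] at h1
    exact exp_ne_zero _ h1.symm
  obtain ⟨Λ, hΛ, hΛe⟩ := exists_continuous_log (u := fun p => F (a p) - F (b p))
    ((hc.comp_continuous hac ham).sub (hc.comp_continuous hbc hbm))
    (fun p h => hab p (hi (ham p) (hbm p) (sub_eq_zero.1 h)))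
  have hexp2 : ∀ θ : ℝ, exp ((θ + 2 * Real.pi : ℝ) * I) = exp (θ * I) := fun θ => by
    push_cast
    rw [add_mul, exp_add, exp_two_pi_mul_I, mul_one]
  have hexp1 : ∀ θ : ℝ, exp ((θ + Real.pi : ℝ) * I) = -exp (θ * I) := fun θ => by
    push_cast
    rw [add_mul, exp_add, exp_pi_mul_I]; ring
  have hH2 : ∀ θ t, F (a (θ + 2 * Real.pi, t)) - F (b (θ + 2 * Real.pi, t))
      = F (a (θ, t)) - F (b (θ, t)) := fun θ t => by simp only [a, b, hexp2]
  have hd0 : ∀ θ, Λ (θ + 2 * Real.pi, 0) = Λ (θ, 0) := fun θ => by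
    have := eq_of_exp_eq (L := fun θ => Λ (θ, 0) - L θ) (by fun_prop) (c := 1) (fun θ => by
      rw [exp_sub, hΛe, hexp, div_eq_one_iff_eq]
      · simp [a, b, k]
      · rw [← hexp]; exact exp_ne_zero _) (θ + 2 * Real.pi) θ
    simp only [hper] at this
    exact sub_left_inj.1 this
  have hd : ∀ θ t, Λ (θ + 2 * Real.pi, t) = Λ (θ, t) := fun θ t => by
    have := eq_of_exp_eq (L := fun p : ℝ × ℝ => Λ (p.1 + 2 * Real.pi, p.2) - Λ p)
      (by fun_prop) (c := 1) (fun p => by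
        rw [exp_sub, hΛe, hΛe, div_eq_one_iff_eq]
        · exact hH2 p.1 p.2
        · rw [← hΛe]; exact exp_ne_zero _) (θ, t) (0, 0)
    simp only [hd0, sub_self] at this
    exact sub_eq_zero.1 this
  have hH1 : ∀ θ, F (a (θ + Real.pi, 1)) - F (b (θ + Real.pi, 1))
      = -(F (a (θ, 1)) - F (b (θ, 1))) := fun θ => by
    simp only [a, b, hexp1]
    simp [k]
  have he : ∀ θ, exp (Λ (θ + Real.pi, 1) - Λ (θ, 1)) = -1 := fun θ => by
    rw [exp_sub, hΛe, hΛe, hH1, neg_div, div_self]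
    rw [← hΛe]; exact exp_ne_zero _
  have h1 := eq_of_exp_eq (L := fun θ : ℝ => Λ (θ + Real.pi, 1) - Λ (θ, 1))
      (by fun_prop) he (0 + Real.pi) 0
  have h2 := hd 0 1
  rw [show (0 : ℝ) + 2 * Real.pi = 0 + Real.pi + Real.pi by ring] at h2
  have h3 : Λ (0 + Real.pi, 1) - Λ (0, 1) = 0 := by
    rw [h2] at h1
    linear_combination (-1 / 2 : ℂ) * h1
  have h4 := he 0
  rw [h3] at h4
  norm_num at h4

theorem image_closedBall_mem_nhds {F : ℂ → ℂ} (hc : ContinuousOn F (closedBall 0 1))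
    (hi : InjOn F (closedBall 0 1)) : F '' closedBall 0 1 ∈ 𝓝 (F 0) := by
  have hsub : sphere (0 : ℂ) 1 ⊆ closedBall 0 1 := sphere_subset_closedBall
  obtain ⟨x0, hx0, hmin⟩ := (isCompact_sphere (0 : ℂ) 1).exists_isMinOn
    ⟨1, by simp⟩ ((hc.mono hsub).sub continuousOn_const).norm (f := fun x => ‖F x - F 0‖)
  have hG : ∀ x ∈ sphere (0 : ℂ) 1, F x - F 0 ≠ 0 := fun x hx h => by
    have := hi (hsub hx) (by simp) (sub_eq_zero.1 h)
    simp [this] at hx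
  refine Metric.mem_nhds_iff.2 ⟨‖F x0 - F 0‖, norm_pos_iff.2 (hG x0 hx0), fun y hy => ?_⟩
  by_contra hny
  have hrm : ∀ z : ℂ, z / (max 1 ‖z‖ : ℝ) ∈ closedBall (0 : ℂ) 1 := fun z => by
    rw [mem_closedBall_zero_iff, norm_div, norm_real, Real.norm_of_nonneg (by positivity),
      div_le_one (by positivity)]
    exact le_max_right _ _
  have hrc : Continuous fun z : ℂ => z / (max 1 ‖z‖ : ℝ) := by
    refine Continuous.div continuous_id (by fun_prop) fun z => ?_
    have : (0 : ℝ) < max 1 ‖z‖ := by positivity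
    exact_mod_cast this.ne'
  obtain ⟨L, hL, hLe⟩ := exists_continuous_log (u := fun z : ℂ => F (z / (max 1 ‖z‖ : ℝ)) - y)
    ((hc.comp_continuous hrc hrm).sub continuous_const)
    (fun z h => hny ⟨_, hrm z, sub_eq_zero.1 h⟩)
  have hsph : ∀ θ : ℝ, exp (θ * I) ∈ sphere (0 : ℂ) 1 := fun θ => by
    simp [norm_exp_ofReal_mul_I]
  have hFc : Continuous fun θ : ℝ => F (exp (θ * I)) :=
    hc.comp_continuous (by fun_prop) fun θ => hsub (hsph θ)
  have hslit : ∀ θ : ℝ, (F (exp (θ * I)) - y) / (F (exp (θ * I)) - F 0) ∈ slitPlane := fun θ => by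
    have h1 := hG _ (hsph θ)
    have : (F (exp (θ * I)) - y) / (F (exp (θ * I)) - F 0)
        = 1 + -((y - F 0) / (F (exp (θ * I)) - F 0)) := by
      field_simp; ring
    rw [this]
    refine mem_slitPlane_of_norm_lt_one ?_
    rw [norm_neg, norm_div, div_lt_one (norm_pos_iff.2 h1)]
    rw [mem_ball, dist_eq_norm] at hy
    exact hy.trans_le (hmin (hsph θ))
  refine not_exists_log_sphere hc hi (L := fun θ => L (exp (θ * I))
    - log ((F (exp (θ * I)) - y) / (F (exp (θ * I)) - F 0))) ?_ (fun θ => ?_) fun θ => ?_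
  · refine Continuous.sub (by fun_prop) (Continuous.clog ?_ hslit)
    exact (hFc.sub continuous_const).div (hFc.sub continuous_const) fun θ => hG _ (hsph θ)
  · have : exp ((θ + 2 * Real.pi : ℝ) * I) = exp (θ * I) := by
      push_cast
      rw [add_mul, exp_add, exp_two_pi_mul_I, mul_one]
    rw [this]
  · rw [exp_sub, hLe, exp_log (slitPlane_ne_zero (hslit θ)), norm_exp_ofReal_mul_I]
    have h1 := hG _ (hsph θ)
    have h2 := slitPlane_ne_zero (hslit θ)
    have h3 := left_ne_zero_of_mul h2
    simp only [max_self, ofReal_one, div_one]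
    field_simp

/-- A half-disc chart: a parametrisation `F` of an open subset of `M` by the part of a disc in the
right half-plane, with inverse `c`. -/
structure IsHalfDisc {M : Type*} [TopologicalSpace M] (w₀ : ℂ) (ε : ℝ) (F : ℂ → M) (c : M → ℂ) :
    Prop where
  pos : 0 < ε
  re_nonneg : 0 ≤ w₀.re
  continuousOn : ContinuousOn F ({w | 0 ≤ w.re} ∩ ball w₀ ε)
  isOpen_image : IsOpen (F '' ({w | 0 ≤ w.re} ∩ ball w₀ ε))
  left_inv : ∀ w ∈ {w : ℂ | 0 ≤ w.re} ∩ ball w₀ ε, c (F w) = w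
  continuousOn_inv : ContinuousOn c (F '' ({w | 0 ≤ w.re} ∩ ball w₀ ε))

/-- The points of `M` that are centres of embedded discs. -/
def IsInner {M : Type*} [TopologicalSpace M] (a : M) : Prop :=
  ∃ F : ℂ → M, ContinuousOn F (closedBall 0 1) ∧ InjOn F (closedBall 0 1) ∧ F 0 = a

section HalfDisc

variable {M : Type*} [TopologicalSpace M]

theorem exists_isHalfDisc [ChartedSpace (EuclideanHalfSpace 2) M] {W : Set M} (hW : IsOpen W)
    {z : M} (hz : z ∈ W) : ∃ w₀ ε F c, IsHalfDisc (M := M) w₀ ε F c ∧ F w₀ = z ∧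
      F '' ({w | 0 ≤ w.re} ∩ ball w₀ ε) ⊆ W := by
  let e := chartAt (EuclideanHalfSpace 2) z
  let ψ : EuclideanHalfSpace 2 → ℂ := fun h => ⟨h.1 0, h.1 1⟩
  let φ : ℂ → EuclideanHalfSpace 2 := fun w => ⟨!₂[max 0 w.re, w.im], by simp⟩
  have hψ : Continuous ψ := by
    have : ψ = fun h => Complex.equivRealProdCLM.symm (h.1 0, h.1 1) := by
      funext h
      apply Complex.ext <;> simp [ψ]
    rw [this]
    have h1 : Continuous fun h : EuclideanHalfSpace 2 => h.1 := continuous_subtype_val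
    fun_prop
  have hφ : Continuous φ := by
    refine Continuous.subtype_mk ?_ _
    refine (PiLp.continuous_toLp 2 _).comp ?_
    refine continuous_pi fun i => ?_
    fin_cases i
    · simpa using continuous_const.max continuous_re
    · simpa using continuous_im
  have hψφ : ∀ w : ℂ, 0 ≤ w.re → ψ (φ w) = w := fun w hw => by
    apply Complex.ext <;> simp [ψ, φ, hw]
  have hφψ : ∀ h, φ (ψ h) = h := fun h => by
    apply Subtype.ext
    ext i
    fin_cases i
    · simpa [ψ, φ] using h.2
    · simp [ψ, φ]
  have hψre : ∀ h, 0 ≤ (ψ h).re := fun h => h.2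
  let V : Set (EuclideanHalfSpace 2) := e.target ∩ e.symm ⁻¹' W
  have hV : IsOpen V := e.isOpen_inter_preimage_symm hW
  have hzs : z ∈ e.source := mem_chart_source _ z
  have hzV : φ (ψ (e z)) ∈ V := by
    rw [hφψ]
    exact ⟨e.map_source hzs, by simpa [e.left_inv hzs] using hz⟩
  obtain ⟨ε, hε, hball⟩ := Metric.isOpen_iff.1 (hV.preimage hφ) (ψ (e z)) hzV
  have himg : (fun w => e.symm (φ w)) '' ({w | 0 ≤ w.re} ∩ ball (ψ (e z)) ε) =
      e.source ∩ e ⁻¹' (ψ ⁻¹' ball (ψ (e z)) ε) := by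
    ext m
    constructor
    · rintro ⟨w, ⟨hw0, hw⟩, rfl⟩
      have h1 : φ w ∈ e.target := (hball hw).1
      refine ⟨e.map_target h1, ?_⟩
      simp only [mem_preimage, e.right_inv h1, hψφ w hw0]
      exact hw
    · rintro ⟨hm, hm2⟩
      exact ⟨ψ (e m), ⟨hψre _, hm2⟩, by simp only [hφψ, e.left_inv hm]⟩
  refine ⟨ψ (e z), ε, fun w => e.symm (φ w), fun m => ψ (e m), ⟨hε, hψre _, ?_, ?_, ?_, ?_⟩, ?_, ?_⟩
  · exact e.continuousOn_symm.comp hφ.continuousOn fun w hw => (hball hw.2).1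
  · rw [himg]
    exact e.isOpen_inter_preimage (isOpen_ball.preimage hψ)
  · intro w hw
    simp only [e.right_inv (hball hw.2).1, hψφ w hw.1]
  · rw [himg]
    exact hψ.comp_continuousOn (e.continuousOn.mono inter_subset_left)
  · simp only [hφψ, e.left_inv hzs]
  · rintro _ ⟨w, hw, rfl⟩
    exact (hball hw.2).2

namespace IsHalfDisc

variable {w₀ : ℂ} {ε : ℝ} {F : ℂ → M} {c : M → ℂ}

theorem injOn (h : IsHalfDisc w₀ ε F c) : InjOn F ({w | 0 ≤ w.re} ∩ ball w₀ ε) :=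
    fun a ha b hb hab => by
  rw [← h.left_inv a ha, hab, h.left_inv b hb]

theorem center_mem (h : IsHalfDisc w₀ ε F c) : w₀ ∈ {w : ℂ | 0 ≤ w.re} ∩ ball w₀ ε :=
  ⟨h.re_nonneg, mem_ball_self h.pos⟩

theorem image_mem_nhds (h : IsHalfDisc w₀ ε F c) {w : ℂ} (hw : w ∈ {w : ℂ | 0 ≤ w.re} ∩ ball w₀ ε)
    {N : Set ℂ} (hN : N ∈ 𝓝 w) : F '' (({w | 0 ≤ w.re} ∩ ball w₀ ε) ∩ N) ∈ 𝓝 (F w) := by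
  have h1 : F '' ({w | 0 ≤ w.re} ∩ ball w₀ ε) ∈ 𝓝 (F w) :=
    h.isOpen_image.mem_nhds (mem_image_of_mem F hw)
  have h2 : c ⁻¹' N ∈ 𝓝 (F w) :=
    (h.continuousOn_inv.continuousAt h1).preimage_mem_nhds (by rwa [h.left_inv w hw])
  filter_upwards [h1, h2]
  rintro _ ⟨u, hu, rfl⟩ hm
  exact ⟨u, ⟨hu, by simpa [h.left_inv u hu] using hm⟩, rfl⟩

/-- A disc embedded in the domain of a half-disc chart is open in the plane around its centre. -/
theorem image_disc_mem_nhds (h : IsHalfDisc w₀ ε F c) {G : ℂ → M} {N : Set ℂ}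
    (hN : N ∈ 𝓝 (0 : ℂ)) (hc : ContinuousOn G N) (hi : InjOn G N)
    {w : ℂ} (hw : w ∈ {w : ℂ | 0 ≤ w.re} ∩ ball w₀ ε) (hG : G 0 = F w) :
    0 < w.re ∧ G '' N ∈ 𝓝 (G 0) := by
  have h1 : F '' ({w | 0 ≤ w.re} ∩ ball w₀ ε) ∈ 𝓝 (G 0) :=
    hG ▸ h.isOpen_image.mem_nhds (mem_image_of_mem F hw)
  have h2 := inter_mem hN ((hc.continuousAt hN).preimage_mem_nhds h1)
  obtain ⟨ρ, hρ, hρN⟩ := Metric.nhds_basis_closedBall.mem_iff.1 h2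
  have hmem : ∀ u ∈ closedBall (0 : ℂ) 1, (ρ : ℂ) * u ∈ closedBall (0 : ℂ) ρ := fun u hu => by
    rw [mem_closedBall_zero_iff] at hu ⊢
    rw [norm_mul, norm_real, Real.norm_of_nonneg hρ.le]
    exact mul_le_of_le_one_right hρ.le hu
  have hcinj : InjOn c (F '' ({w | 0 ≤ w.re} ∩ ball w₀ ε)) := by
    rintro _ ⟨a, ha, rfl⟩ _ ⟨b, hb, rfl⟩ hab
    rw [h.left_inv a ha, h.left_inv b hb] at hab
    rw [hab]
  have key := image_closedBall_mem_nhds (F := fun u => c (G (ρ * u)))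
    (h.continuousOn_inv.comp (hc.comp (by fun_prop) fun u hu => (hρN (hmem u hu)).1)
      fun u hu => (hρN (hmem u hu)).2)
    (fun a ha b hb hab => by
      have := hi (hρN (hmem a ha)).1 (hρN (hmem b hb)).1
        (hcinj (hρN (hmem a ha)).2 (hρN (hmem b hb)).2 hab)
      exact mul_left_cancel₀ (by exact_mod_cast hρ.ne') this)
  simp only [mul_zero, hG, h.left_inv w hw] at key
  constructor
  · obtain ⟨η, hη, hηN⟩ := Metric.nhds_basis_closedBall.mem_iff.1 key
    obtain ⟨u, hu, hu2⟩ := hηN (show w - (η : ℂ) ∈ closedBall w η by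
      simp [abs_of_pos hη])
    obtain ⟨w', hw', hw'2⟩ := (hρN (hmem u hu)).2
    have : 0 ≤ (w - (η : ℂ)).re := by
      rw [← hu2]; simp only [← hw'2, h.left_inv w' hw']; exact hw'.1
    simp at this
    linarith
  · rw [hG]
    filter_upwards [h.image_mem_nhds hw key]
    rintro _ ⟨a, ⟨ha, u, hu, hua⟩, rfl⟩
    refine ⟨ρ * u, (hρN (hmem u hu)).1, ?_⟩
    obtain ⟨w', hw', hw'2⟩ := (hρN (hmem u hu)).2
    simp only [← hw'2, h.left_inv w' hw'] at hua
    rw [← hw'2, hua]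

theorem re_pos_of_isInner (h : IsHalfDisc w₀ ε F c) {w : ℂ}
    (hw : w ∈ {w : ℂ | 0 ≤ w.re} ∩ ball w₀ ε) (hF : IsInner (F w)) : 0 < w.re := by
  obtain ⟨G, hc, hi, hG⟩ := hF
  exact (h.image_disc_mem_nhds (closedBall_mem_nhds 0 one_pos) hc hi hw hG).1

end IsHalfDisc

theorem isInner_of_nhds {G : ℂ → M} {p : ℂ} {N : Set ℂ} (hN : N ∈ 𝓝 p)
    (hc : ContinuousOn G N) (hi : InjOn G N) : IsInner (G p) := by
  obtain ⟨ρ, hρ, hρN⟩ := Metric.nhds_basis_closedBall.mem_iff.1 hN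
  have hmem : ∀ u ∈ closedBall (0 : ℂ) 1, p + (ρ : ℂ) * u ∈ N := fun u hu => hρN <| by
    rw [mem_closedBall_zero_iff] at hu
    rw [mem_closedBall, dist_eq_norm, add_sub_cancel_left, norm_mul, norm_real,
      Real.norm_of_nonneg hρ.le]
    exact mul_le_of_le_one_right hρ.le hu
  refine ⟨fun u => G (p + ρ * u), hc.comp (by fun_prop) hmem, fun a ha b hb hab => ?_, by simp⟩
  have := hi (hmem a ha) (hmem b hb) hab
  exact mul_left_cancel₀ (by exact_mod_cast hρ.ne') (add_left_cancel this)

/-- Invariance of domain for maps of planar open sets to a surface. -/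
theorem image_mem_nhds_of_injOn [ChartedSpace (EuclideanHalfSpace 2) M] {G : ℂ → M} {p : ℂ}
    {N : Set ℂ} (hN : N ∈ 𝓝 p) (hc : ContinuousOn G N) (hi : InjOn G N) : G '' N ∈ 𝓝 (G p) := by
  obtain ⟨w₀, ε, F, c, h, hF, -⟩ := exists_isHalfDisc isOpen_univ (mem_univ (G p))
  have h2 : (fun u => p + u) ⁻¹' N ∈ 𝓝 (0 : ℂ) :=
    (Continuous.continuousAt (by fun_prop)).preimage_mem_nhds (by simpa using hN)
  have := (h.image_disc_mem_nhds h2 (G := fun u => G (p + u))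
    (hc.comp (by fun_prop) fun u hu => hu) (fun a ha b hb hab => by
      simpa using hi ha hb hab) h.center_mem (by simp [hF])).2
  simp only [add_zero] at this
  refine mem_of_superset this ?_
  rintro _ ⟨u, hu, rfl⟩
  exact ⟨p + u, hu, rfl⟩

theorem isOpen_image_of_injOn [ChartedSpace (EuclideanHalfSpace 2) M] {G : ℂ → M}
    {N : Set ℂ} (hN : IsOpen N) (hc : ContinuousOn G N) (hi : InjOn G N) : IsOpen (G '' N) := by
  rw [isOpen_iff_mem_nhds]
  rintro _ ⟨p, hp, rfl⟩
  exact image_mem_nhds_of_injOn (hN.mem_nhds hp) hc hi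

theorem exists_isInner_mem [ChartedSpace (EuclideanHalfSpace 2) M] {W : Set M} (hW : IsOpen W)
    (hne : W.Nonempty) : ∃ a ∈ W, IsInner a := by
  obtain ⟨z, hz⟩ := hne
  obtain ⟨w₀, ε, F, c, h, -, hFW⟩ := exists_isHalfDisc hW hz
  have hε := h.pos
  have hmem : w₀ + (ε / 2 : ℝ) ∈ {w : ℂ | 0 < w.re} ∩ ball w₀ ε := by
    refine ⟨?_, ?_⟩
    · have := h.re_nonneg
      simp only [mem_ofPred_eq, add_re, ofReal_re]; linarith
    · rw [mem_ball, dist_eq_norm, add_sub_cancel_left, norm_real, Real.norm_of_nonneg (by linarith)]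
      linarith
  have hsub : {w : ℂ | 0 < w.re} ∩ ball w₀ ε ⊆ {w : ℂ | 0 ≤ w.re} ∩ ball w₀ ε :=
    inter_subset_inter_left _ fun w (hw : 0 < w.re) => hw.le
  have ho : IsOpen ({w : ℂ | 0 < w.re} ∩ ball w₀ ε) :=
    (isOpen_lt continuous_const continuous_re).inter isOpen_ball
  exact ⟨_, hFW (mem_image_of_mem F (hsub hmem)),
    isInner_of_nhds (ho.mem_nhds hmem) (h.continuousOn.mono hsub) (h.injOn.mono hsub)⟩

end HalfDisc

theorem continuousOn_of_closed_cover {M N : Type*} [TopologicalSpace M]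
    [TopologicalSpace N] {φ : M → N} {D C₁ C₂ : Set M}
    (h₁ : IsClosed C₁) (h₂ : IsClosed C₂) (hD : D ⊆ C₁ ∪ C₂) (hc₁ : ContinuousOn φ (D ∩ C₁))
    (hc₂ : ContinuousOn φ (D ∩ C₂)) : ContinuousOn φ D := by
  have key : ∀ {C : Set M}, IsClosed C → ContinuousOn φ (D ∩ C) → ∀ m ∈ D,
      ContinuousWithinAt φ (D ∩ C) m := fun {C} hC hφ m hm => by
    by_cases hmC : m ∈ C
    · exact hφ m ⟨hm, hmC⟩
    · refine continuousWithinAt_of_notMem_closure fun h => hmC ?_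
      exact hC.closure_subset_iff.2 inter_subset_right h
  intro m hm
  refine ((key h₁ hc₁ m hm).union (key h₂ hc₂ m hm)).mono fun x hx => ?_
  exact (hD hx).imp (fun h => ⟨hx, h⟩) fun h => ⟨hx, h⟩

section Extend

variable {X M : Type*} [TopologicalSpace X] [TopologicalSpace M] [T2Space M]

theorem map_nhdsWithin_of_injOn {F : X → M} {K S : Set X} (hK : IsCompact K)
    (hc : ContinuousOn F K) (hi : InjOn F K) (hS : S ⊆ K) {x : X} (hx : x ∈ K) :
    map F (𝓝[S] x) = 𝓝[F '' S] (F x) := by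
  let Fr : K → M := K.domRestrict F
  have hFr : IsClosedEmbedding Fr := by
    have := isCompact_iff_compactSpace.1 hK
    exact IsClosedEmbedding.of_continuous_injective_isClosedMap hc.domRestrict hi.injective
      hc.domRestrict.isClosedMap
  have h1 := hFr.isInducing.map_nhdsWithin_eq (Subtype.val ⁻¹' S) ⟨x, hx⟩
  have h2 := IsInducing.subtypeVal.map_nhdsWithin_eq (Subtype.val ⁻¹' S) (⟨x, hx⟩ : K)
  rw [Subtype.image_preimage_coe, inter_eq_right.2 hS] at h2
  have h3 : Fr '' (Subtype.val ⁻¹' S) = F '' S := by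
    have : Fr = F ∘ Subtype.val := rfl
    rw [this, image_comp, Subtype.image_preimage_coe, inter_eq_right.2 hS]
  rw [h3] at h1
  rw [← h2, map_map]
  exact h1

/-- Gluing a map defined on part of an embedded compact set with a map defined elsewhere. -/
theorem exists_continuousOn_glue {N : Type*} [TopologicalSpace N] {F : X → M} {K K' O : Set X}
    {D : Set M} (hK : IsCompact K) (hc : ContinuousOn F K) (hi : InjOn F K) (hK' : K' ⊆ K)
    (hO : IsOpen (F '' O)) (hOK : O ⊆ K) (hD : ∀ x ∈ K, F x ∈ D → x ∈ K') {g : X → N} {h : M → N}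
    (hg : ContinuousOn g K') (hh : ContinuousOn h D) (hgh : ∀ x ∈ K', x ∉ O → g x = h (F x)) :
    ∃ φ : M → N, ContinuousOn φ D ∧ (∀ x ∈ K', φ (F x) = g x) ∧ ∀ m ∈ D,
      m ∉ F '' O → φ m = h m := by
  classical
  let φ : M → N := fun m => if hm : m ∈ F '' K' then g hm.choose else h m
  have h1 : ∀ x ∈ K', φ (F x) = g x := fun x hx => by
    have hm : F x ∈ F '' K' := ⟨x, hx, rfl⟩
    have : hm.choose = x := hi (hK' hm.choose_spec.1) (hK' hx) hm.choose_spec.2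
    simp only [φ, dif_pos hm, this]
  have h2 : ∀ m ∈ D, m ∉ F '' O → φ m = h m := fun m _ hmO => by
    by_cases hm : m ∈ F '' K'
    · obtain ⟨x, hx, rfl⟩ := hm
      rw [h1 x hx, hgh x hx fun hxO => hmO ⟨x, hxO, rfl⟩]
    · simp only [φ, dif_neg hm]
  refine ⟨φ, ?_, h1, h2⟩
  refine continuousOn_of_closed_cover (hK.image_of_continuousOn hc).isClosed hO.isClosed_compl
    (fun m _ => ?_) ?_ ?_
  · by_cases hm : m ∈ F '' O
    · exact Or.inl (image_mono hOK hm)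
    · exact Or.inr hm
  · rintro _ ⟨hD', x, hx, rfl⟩
    have hx' := hD x hx hD'
    have : ContinuousWithinAt φ (F '' K') (F x) := by
      rw [ContinuousWithinAt, ← map_nhdsWithin_of_injOn hK hc hi hK' hx, tendsto_map'_iff, h1 x hx']
      exact (hg x hx').congr' (by
        filter_upwards [self_mem_nhdsWithin] with y hy using (h1 y hy).symm)
    refine this.mono ?_
    rintro _ ⟨hyD, y, hy, rfl⟩
    exact ⟨y, hD y hy hyD, rfl⟩
  · exact (hh.mono inter_subset_left).congr fun m hm => h2 m hm.1 hm.2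

theorem exists_continuous_extend {F : X → M} {K O : Set X} (hK : IsCompact K)
    (hc : ContinuousOn F K) (hi : InjOn F K) (hOK : O ⊆ K) (hO : IsOpen (F '' O)) (t : X ≃ₜ X)
    (ht : ∀ x, x ∉ O → t x = x) :
    ∃ φ : M → M, Continuous φ ∧ (∀ x ∈ K, φ (F x) = F (t x)) ∧ ∀ m ∉ F '' O, φ m = m := by
  have htK : ∀ x ∈ K, t x ∈ K := fun x hx => by
    by_cases h : t x ∈ O
    · exact hOK h
    · rwa [t.injective (ht _ h)]
  obtain ⟨φ, h0, h1, h2⟩ := exists_continuousOn_glue hK hc hi subset_rfl hO hOK (D := univ)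
    (fun x hx _ => hx) (hc.comp t.continuous.continuousOn htK) continuousOn_id
    (fun x _ hxO => by simp [ht x hxO])
  exact ⟨φ, continuousOn_univ.1 h0, h1, fun m hm => h2 m (mem_univ m) hm⟩

/-- A homeomorphism supported in the interior of an embedded compact set extends by the identity. -/
theorem exists_homeomorph_extend {F : X → M} {K O : Set X} (hK : IsCompact K)
    (hc : ContinuousOn F K) (hi : InjOn F K) (hOK : O ⊆ K) (hO : IsOpen (F '' O)) (t : X ≃ₜ X)
    (ht : ∀ x, x ∉ O → t x = x) :
    ∃ φ : M ≃ₜ M, (∀ x ∈ K, φ (F x) = F (t x)) ∧ ∀ m ∉ F '' O, φ m = m := by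
  have key : ∀ s : X ≃ₜ X, (∀ x, x ∉ O → s x = x) → ∀ {φ ψ : M → M},
      (∀ x ∈ K, φ (F x) = F (s x)) → (∀ m ∉ F '' O, φ m = m) →
      (∀ x ∈ K, ψ (F x) = F (s.symm x)) → (∀ m ∉ F '' O, ψ m = m) → ∀ m, ψ (φ m) = m := by
    intro s hs φ ψ h1 h2 h3 h4 m
    by_cases hm : m ∈ F '' O
    · obtain ⟨x, hx, rfl⟩ := hm
      have : s x ∈ O := by
        by_contra h
        have := s.injective (hs _ h)
        exact h (this.symm ▸ hx)
      rw [h1 x (hOK hx), h3 _ (hOK this), s.symm_apply_apply]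
    · rw [h2 m hm, h4 m hm]
  have ht' : ∀ x, x ∉ O → t.symm x = x := fun x hx => by rw [t.symm_apply_eq, ht x hx]
  obtain ⟨φ, hφ, h1, h2⟩ := exists_continuous_extend hK hc hi hOK hO t ht
  obtain ⟨ψ, hψ, h3, h4⟩ := exists_continuous_extend hK hc hi hOK hO t.symm ht'
  exact ⟨⟨⟨φ, ψ, key t ht h1 h2 h3 h4, key t.symm ht' h3 h4 h1 h2⟩, hφ, hψ⟩, h1, h2⟩

end Extend

/-- A homeomorphism of the plane supported in the unit disc and moving the centre to `v`. -/
theorem exists_homeomorph_moveCenter {v : ℂ} (hv : ‖v‖ < 1) :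
    ∃ t : ℂ ≃ₜ ℂ, t 0 = v ∧ ∀ z, z ∉ ball (0 : ℂ) 1 → t z = z := by
  let f : ℂ → ℂ := fun z => z + (max 0 (1 - ‖z‖) : ℝ) * v
  have hf : ApproximatesLinearOn f ((ContinuousLinearEquiv.refl ℝ ℂ : ℂ ≃L[ℝ] ℂ) : ℂ →L[ℝ] ℂ) univ
      ‖v‖₊ := by
    intro a _ b _
    have h1 : f a - f b - ((ContinuousLinearEquiv.refl ℝ ℂ : ℂ ≃L[ℝ] ℂ) : ℂ →L[ℝ] ℂ) (a - b)
        = ((max 0 (1 - ‖a‖) - max 0 (1 - ‖b‖) : ℝ) : ℂ) * v := by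
      simp [f]; ring
    rw [h1, norm_mul, norm_real, mul_comm, coe_nnnorm]
    refine mul_le_mul_of_nonneg_left ?_ (norm_nonneg _)
    rw [Real.norm_eq_abs]
    calc |max 0 (1 - ‖a‖) - max 0 (1 - ‖b‖)| ≤ |(1 - ‖a‖) - (1 - ‖b‖)| := by
          rw [max_comm 0, max_comm 0]
          exact abs_max_sub_max_le_abs (1 - ‖a‖) (1 - ‖b‖) 0
      _ = |‖b‖ - ‖a‖| := by ring_nf
      _ ≤ ‖b - a‖ := abs_norm_sub_norm_le _ _
      _ = ‖a - b‖ := norm_sub_rev _ _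
  have hc : Subsingleton ℂ ∨ ‖v‖₊ <
      ‖(((ContinuousLinearEquiv.refl ℝ ℂ : ℂ ≃L[ℝ] ℂ).symm : ℂ ≃L[ℝ] ℂ) : ℂ →L[ℝ] ℂ)‖₊⁻¹ := by
    right
    have : (((ContinuousLinearEquiv.refl ℝ ℂ : ℂ ≃L[ℝ] ℂ).symm : ℂ ≃L[ℝ] ℂ) : ℂ →L[ℝ] ℂ)
      = ContinuousLinearMap.id ℝ ℂ := rfl
    rw [this, ← NNReal.coe_lt_coe]
    simpa using hv
  refine ⟨hf.toHomeomorph f hc, ?_, fun z hz => ?_⟩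
  · change f 0 = v
    simp [f]
  · change f z = z
    have : 1 ≤ ‖z‖ := by simpa using hz
    simp [f, this]

section Homogeneity

variable {M : Type*} [TopologicalSpace M] [T2Space M] [ChartedSpace (EuclideanHalfSpace 2) M]

theorem exists_homeomorph_move_disc {G : ℂ → M} {p y : ℂ} {r : ℝ}
    (hc : ContinuousOn G (closedBall p r)) (hi : InjOn G (closedBall p r)) (hy : y ∈ ball p r) :
    ∃ φ : M ≃ₜ M, φ (G p) = G y ∧ ∀ m ∉ G '' closedBall p r, φ m = m := by
  have hr : 0 < r := pos_of_mem_ball hy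
  have hr' : (r : ℂ) ≠ 0 := by exact_mod_cast hr.ne'
  obtain ⟨t, ht0, ht⟩ := exists_homeomorph_moveCenter (v := (y - p) / r) (by
    rw [norm_div, norm_real, Real.norm_of_nonneg hr.le, div_lt_one hr]
    simpa [dist_eq_norm] using hy)
  let a : ℂ ≃ₜ ℂ := (Homeomorph.subRight p).trans (Homeomorph.mulRight₀ (r : ℂ)⁻¹ (inv_ne_zero hr'))
  have ha : ∀ z, a z = (z - p) * (r : ℂ)⁻¹ := fun z => rfl
  obtain ⟨φ, h1, h2⟩ := exists_homeomorph_extend (isCompact_closedBall p r) hc hi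
    ball_subset_closedBall (isOpen_image_of_injOn isOpen_ball (hc.mono ball_subset_closedBall)
      (hi.mono ball_subset_closedBall)) (a.trans (t.trans a.symm)) (fun z hz => by
        simp only [Homeomorph.trans_apply]
        rw [ht, a.symm_apply_apply]
        rw [ha, mem_ball_zero_iff, norm_mul, norm_inv, norm_real, Real.norm_of_nonneg hr.le,
          ← div_eq_mul_inv, div_lt_one hr]
        simpa [dist_eq_norm] using hz)
  refine ⟨φ, ?_, fun m hm => h2 m fun h => hm (image_mono ball_subset_closedBall h)⟩
  rw [h1 p (mem_closedBall_self hr.le)]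
  simp only [Homeomorph.trans_apply]
  rw [ha, sub_self, zero_mul, ht0, div_eq_mul_inv, ← ha, a.symm_apply_apply]

theorem exists_homeomorph_move_halfDisc {w₀ : ℂ} {ε : ℝ} {F : ℂ → M} {c : M → ℂ}
    (h : IsHalfDisc w₀ ε F c) {a b : M} (ha : a ∈ F '' ({w | 0 ≤ w.re} ∩ ball w₀ ε))
    (hb : b ∈ F '' ({w | 0 ≤ w.re} ∩ ball w₀ ε)) (ha' : IsInner a) (hb' : IsInner b) :
    ∃ φ : M ≃ₜ M, φ a = b ∧ ∀ m ∉ F '' ({w | 0 ≤ w.re} ∩ ball w₀ ε), φ m = m := by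
  obtain ⟨u, hu, rfl⟩ := ha
  obtain ⟨v, hv, rfl⟩ := hb
  have hsub : {w : ℂ | 0 < w.re} ∩ ball w₀ ε ⊆ {w : ℂ | 0 ≤ w.re} ∩ ball w₀ ε :=
    inter_subset_inter_left _ fun w (hw : 0 < w.re) => hw.le
  have ho : IsOpen ({w : ℂ | 0 < w.re} ∩ ball w₀ ε) :=
    (isOpen_lt continuous_const continuous_re).inter isOpen_ball
  have hconv : IsPreconnected ({w : ℂ | 0 < w.re} ∩ ball w₀ ε) :=
    ((convex_halfSpace_re_gt 0).inter (convex_ball _ _)).isPreconnected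
  refine hconv.induction₂ (fun x y => ∃ φ : M ≃ₜ M, φ (F x) = F y ∧
    ∀ m ∉ F '' ({w | 0 ≤ w.re} ∩ ball w₀ ε), φ m = m) ?_ ?_ ?_
    ⟨h.re_pos_of_isInner hu ha', hu.2⟩ ⟨h.re_pos_of_isInner hv hb', hv.2⟩
  · intro x hx
    obtain ⟨ρ, hρ, hρN⟩ := Metric.nhds_basis_closedBall.mem_iff.1 (ho.mem_nhds hx)
    filter_upwards [mem_nhdsWithin_of_mem_nhds (ball_mem_nhds x hρ)] with y hy
    obtain ⟨φ, h1, h2⟩ := exists_homeomorph_move_disc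
      (h.continuousOn.mono (hρN.trans hsub)) (h.injOn.mono (hρN.trans hsub)) hy
    exact ⟨φ, h1, fun m hm => h2 m fun hm' => hm (image_mono (hρN.trans hsub) hm')⟩
  · rintro x y z - - - ⟨φ, h1, h2⟩ ⟨ψ, h3, h4⟩
    exact ⟨φ.trans ψ, by simp [h1, h3], fun m hm => by simp [h2 m hm, h4 m hm]⟩
  · rintro x y - - ⟨φ, h1, h2⟩
    exact ⟨φ.symm, by simp [← h1], fun m hm => by rw [φ.symm_apply_eq, h2 m hm]⟩

/-- Inner points of a connected open set can be moved to each other by a homeomorphism supported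
in that set. -/
theorem exists_homeomorph_move {W : Set M} (hW : IsOpen W) (hWc : IsPreconnected W) {a b : M}
    (ha : a ∈ W) (hb : b ∈ W) (ha' : IsInner a) (hb' : IsInner b) :
    ∃ φ : M ≃ₜ M, φ a = b ∧ ∀ m ∉ W, φ m = m := by
  have key := hWc.induction₂ (fun x y => ∃ U ∈ 𝓝 x, ∃ V ∈ 𝓝 y, ∀ a ∈ U ∩ W, ∀ b ∈ V ∩ W,
    IsInner a → IsInner b → ∃ φ : M ≃ₜ M, φ a = b ∧ ∀ m ∉ W, φ m = m) ?_ ?_ ?_ ha hb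
  · obtain ⟨U, hU, V, hV, h⟩ := key
    exact h a ⟨mem_of_mem_nhds hU, ha⟩ b ⟨mem_of_mem_nhds hV, hb⟩ ha' hb'
  · intro x hx
    obtain ⟨w₀, ε, F, c, h, hF, hFW⟩ := exists_isHalfDisc hW hx
    have hD : F '' ({w | 0 ≤ w.re} ∩ ball w₀ ε) ∈ 𝓝 x :=
      hF ▸ h.isOpen_image.mem_nhds (mem_image_of_mem F h.center_mem)
    filter_upwards [mem_nhdsWithin_of_mem_nhds hD] with y hy
    refine ⟨_, hD, _, h.isOpen_image.mem_nhds hy, fun a ha b hb ha' hb' => ?_⟩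
    obtain ⟨φ, h1, h2⟩ := exists_homeomorph_move_halfDisc h ha.1 hb.1 ha' hb'
    exact ⟨φ, h1, fun m hm => h2 m fun hm' => hm (hFW hm')⟩
  · rintro x y z - hy - ⟨U, hU, V, hV, h⟩ ⟨V', hV', U', hU', h'⟩
    obtain ⟨d, hd, hd'⟩ := exists_isInner_mem (W := interior (V ∩ V') ∩ W)
      (isOpen_interior.inter hW) ⟨y, mem_interior_iff_mem_nhds.2 (inter_mem hV hV'), hy⟩
    have hdV := interior_subset hd.1
    refine ⟨U, hU, U', hU', fun a ha b hb ha' hb' => ?_⟩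
    obtain ⟨φ, h1, h2⟩ := h a ha d ⟨hdV.1, hd.2⟩ ha' hd'
    obtain ⟨ψ, h3, h4⟩ := h' d ⟨hdV.2, hd.2⟩ b hb hd' hb'
    exact ⟨φ.trans ψ, by simp [h1, h3], fun m hm => by simp [h2 m hm, h4 m hm]⟩
  · rintro x y - - ⟨U, hU, V, hV, h⟩
    refine ⟨V, hV, U, hU, fun a ha b hb ha' hb' => ?_⟩
    obtain ⟨φ, h1, h2⟩ := h b hb a ha hb' ha'
    exact ⟨φ.symm, by simp [← h1], fun m hm => by rw [φ.symm_apply_eq, h2 m hm]⟩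

end Homogeneity

theorem isPreconnected_compl_of_diff {X : Type*} [TopologicalSpace X] [PreconnectedSpace X]
    {K U : Set X} (hK : IsClosed K) (hU : IsOpen U) (hKU : K ⊆ U) (h : IsPreconnected (U \ K)) :
    IsPreconnected Kᶜ := by
  have key : ∀ u v : Set X, IsOpen u → IsOpen v → Kᶜ ⊆ u ∪ v → Kᶜ ∩ (u ∩ v) = ∅ →
      U \ K ⊆ u → Kᶜ ⊆ u ∨ Kᶜ ⊆ v := by
    intro u v hu hv huv hd hs
    have h1 := isPreconnected_iff_subset_of_disjoint.1 (isPreconnected_univ (α := X))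
      (u ∩ Kᶜ ∪ U) (v ∩ Kᶜ) ((hu.inter hK.isOpen_compl).union hU) (hv.inter hK.isOpen_compl)
      (fun x _ => by
        by_cases hx : x ∈ K
        · exact Or.inl (Or.inr (hKU hx))
        · rcases huv hx with h | h
          · exact Or.inl (Or.inl ⟨h, hx⟩)
          · exact Or.inr ⟨h, hx⟩)
      (by
        rw [univ_inter, eq_empty_iff_forall_notMem]
        rintro x ⟨hx | hx, hxv, hxK⟩
        · exact eq_empty_iff_forall_notMem.1 hd x ⟨hxK, hx.1, hxv⟩
        · exact eq_empty_iff_forall_notMem.1 hd x ⟨hxK, hs ⟨hx, hxK⟩, hxv⟩)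
    rcases h1 with h1 | h1
    · left
      intro x hx
      rcases h1 (mem_univ x) with h2 | h2
      · exact h2.1
      · exact hs ⟨h2, hx⟩
    · right
      exact fun x _ => (h1 (mem_univ x)).1
  rw [isPreconnected_iff_subset_of_disjoint]
  intro u v hu hv huv hd
  rcases isPreconnected_iff_subset_of_disjoint.1 h u v hu hv (fun x hx => huv hx.2)
    (by
      rw [eq_empty_iff_forall_notMem] at hd ⊢
      exact fun x hx => hd x ⟨hx.1.2, hx.2⟩) with hs | hs
  · exact key u v hu hv huv hd hs
  · exact (key v u hv hu (by rwa [union_comm]) (by rwa [inter_comm v]) hs).symm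

/-- An ultrafilter converging to infinity determines an end of the space. -/
theorem exists_component_mem_ultrafilter {X : Type*} [TopologicalSpace X] [T2Space X]
    [LocallyCompactSpace X] [LocallyConnectedSpace X] [ConnectedSpace X] {L : Set X}
    (hL : IsCompact L) {𝒰 : Ultrafilter X} (h𝒰 : (𝒰 : Filter X) ≤ cocompact X) :
    ∃ C ∈ 𝒰, IsOpen C ∧ IsPreconnected C ∧ C ⊆ Lᶜ := by
  obtain ⟨x0⟩ : Nonempty X := inferInstance
  obtain ⟨L', hL', hLL'⟩ := exists_compact_superset (hL.union (isCompact_singleton (x := x0)))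
  have hsub : L ⊆ interior L' := subset_union_left.trans hLL'
  have hx0 : x0 ∈ L' := interior_subset (hLL' (Or.inr rfl))
  have hfr : frontier L' ⊆ Lᶜ := fun x hx hxL => hx.2 (hsub hxL)
  have hcomp : IsCompact (frontier L') := hL'.of_isClosed_subset isClosed_frontier
    hL'.isClosed.frontier_subset
  have hopen : ∀ x, IsOpen (connectedComponentIn Lᶜ x) := fun x =>
    hL.isClosed.isOpen_compl.connectedComponentIn
  obtain ⟨T, hT, hTc⟩ := hcomp.elim_nhds_subcover (fun x => connectedComponentIn Lᶜ x)
    fun x hx => (hopen x).mem_nhds (mem_connectedComponentIn (hfr hx))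
  have hcov : L'ᶜ ⊆ ⋃ p ∈ T, connectedComponentIn Lᶜ p := by
    intro q hq
    have hqL : q ∈ Lᶜ := fun h => hq (interior_subset (hsub h))
    have hqC := mem_connectedComponentIn hqL
    have hne : (connectedComponentIn Lᶜ q ∩ frontier L').Nonempty := by
      by_contra hempty
      rw [not_nonempty_iff_eq_empty] at hempty
      have hCL' : connectedComponentIn Lᶜ q ⊆ L'ᶜ := by
        refine (isPreconnected_iff_subset_of_disjoint.1 isPreconnected_connectedComponentIn
          (interior L') L'ᶜ isOpen_interior hL'.isClosed.isOpen_compl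
            (fun y hy => ?_) ?_).resolve_left
          fun h => hq (interior_subset (h hqC))
        · by_contra hnot
          rw [mem_union, not_or, mem_compl_iff, not_not] at hnot
          exact eq_empty_iff_forall_notMem.1 hempty y ⟨hy, subset_closure hnot.2, hnot.1⟩
        · exact eq_empty_iff_forall_notMem.2 fun y hy => hy.2.2 (interior_subset hy.2.1)
      have hclosed : IsClosed (connectedComponentIn Lᶜ q) := by
        refine isClosed_of_closure_subset fun y hy => ?_
        have hyL : y ∈ Lᶜ := by
          have : closure (connectedComponentIn Lᶜ q) ⊆ (interior L')ᶜ := by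
            rw [← closure_compl]; exact closure_mono hCL'
          exact fun h => this hy (hsub h)
        obtain ⟨z, hz, hz'⟩ := mem_closure_iff.1 hy _ (hopen y) (mem_connectedComponentIn hyL)
        rw [connectedComponentIn_eq hz', ← connectedComponentIn_eq hz]
        exact mem_connectedComponentIn hyL
      have := IsClopen.eq_univ ⟨hclosed, hopen q⟩ ⟨q, hqC⟩
      exact hCL' (this ▸ mem_univ x0) hx0
    obtain ⟨y, hy, hyf⟩ := hne
    obtain ⟨p, hp, hyp⟩ := mem_iUnion₂.1 (hTc hyf)
    refine mem_iUnion₂.2 ⟨p, hp, ?_⟩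
    rw [connectedComponentIn_eq hyp, ← connectedComponentIn_eq hy]
    exact hqC
  have hmem : (⋃ p ∈ (T : Set X), connectedComponentIn Lᶜ p) ∈ 𝒰 :=
    mem_of_superset (h𝒰 hL'.compl_mem_cocompact) (by simpa using hcov)
  obtain ⟨p, -, hp⟩ := (Ultrafilter.finite_biUnion_mem_iff T.finite_toSet).1 hmem
  exact ⟨_, hp, hopen p, isPreconnected_connectedComponentIn, connectedComponentIn_subset _ _⟩

instance : LocallyCompactSpace (EuclideanHalfSpace 2) :=
  IsClosed.locallyCompactSpace (X := EuclideanSpace ℝ (Fin 2)) (s := {x | 0 ≤ x 0})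
    (isClosed_le continuous_const (by fun_prop))

/-- A point outside a compact set with connected complement can be pushed off to infinity. -/
theorem exists_continuous_avoid {M : Type*} [TopologicalSpace M] [T2Space M] [SigmaCompactSpace M]
    [ChartedSpace (EuclideanHalfSpace 2) M] [ConnectedSpace M] (hnc : ¬ CompactSpace M)
    {K : Set M} (hK : IsCompact K) (hKc : IsPreconnected Kᶜ) {x : M} (hx : x ∉ K)
    (hx' : IsInner x) : ∃ Ψ : M → M, Continuous Ψ ∧ (∀ m ∈ K, Ψ m = m) ∧ ∀ m, Ψ m ≠ x := by
  have : LocallyCompactSpace M := ChartedSpace.locallyCompactSpace (EuclideanHalfSpace 2) M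
  have : LocallyConnectedSpace M := ChartedSpace.locallyConnectedSpace (EuclideanHalfSpace 2) M
  have : NoncompactSpace M := not_compactSpace_iff.1 hnc
  let 𝒰 : Ultrafilter M := Ultrafilter.of (cocompact M)
  have h𝒰 : (𝒰 : Filter M) ≤ cocompact M := Ultrafilter.of_le _
  let E := CompactExhaustion.choice M
  let L : ℕ → Set M := fun k => k.casesOn K fun k => K ∪ E k
  have hL : ∀ k, IsCompact (L k) := by
    rintro (_ | k)
    · exact hK
    · exact hK.union (E.isCompact k)
  have hLmono : ∀ k, L k ⊆ L (k + 1) := by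
    rintro (_ | k)
    · exact subset_union_left
    · exact union_subset_union_right _ (E.subset_succ k)
  have hC : ∀ k, ∃ C ∈ 𝒰, IsOpen C ∧ IsPreconnected C ∧ C ⊆ (L k)ᶜ ∧ (k = 0 → x ∈ C) := by
    rintro (_ | k)
    · exact ⟨Kᶜ, h𝒰 hK.compl_mem_cocompact, hK.isClosed.isOpen_compl, hKc, subset_rfl, fun _ => hx⟩
    · obtain ⟨C, h1, h2, h3, h4⟩ := exists_component_mem_ultrafilter (hL (k + 1)) h𝒰
      exact ⟨C, h1, h2, h3, h4, by simp⟩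
  choose C hC𝒰 hCo hCc hCL hC0 using hC
  have hp : ∀ k, ∃ p ∈ C k ∩ C (k + 1), IsInner p := fun k =>
    exists_isInner_mem ((hCo k).inter (hCo (k + 1)))
      (𝒰.nonempty_of_mem (inter_mem (hC𝒰 k) (hC𝒰 (k + 1))))
  choose p hpC hpI using hp
  let q : ℕ → M := fun k => k.casesOn x p
  have hqC : ∀ k, q k ∈ C k := by
    rintro (_ | k)
    · exact hC0 0 rfl
    · exact (hpC k).2
  have hqI : ∀ k, IsInner (q k) := by
    rintro (_ | k)
    · exact hx'
    · exact hpI k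
  have hφ : ∀ k, ∃ φ : M ≃ₜ M, φ (q k) = q (k + 1) ∧ ∀ m ∉ C k, φ m = m := fun k =>
    exists_homeomorph_move (hCo k) (hCc k) (hqC k) (hpC k).1 (hqI k) (hqI (k + 1))
  choose φ hφq hφC using hφ
  let Ψ : ℕ → M ≃ₜ M := fun k => k.rec (Homeomorph.refl M) fun k ψ => (φ k).symm.trans ψ
  have hΨs : ∀ k m, Ψ (k + 1) m = Ψ k ((φ k).symm m) := fun k m => rfl
  have hΨq : ∀ k, Ψ k (q k) = x := by
    intro k
    induction k with
    | zero => rfl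
    | succ k ih => rw [hΨs, ← hφq, Homeomorph.symm_apply_apply, ih]
  have hstep : ∀ k, ∀ m ∈ L k, Ψ (k + 1) m = Ψ k m := fun k m hm => by
    rw [hΨs, (φ k).symm_apply_eq.2 (hφC k m fun h => hCL k h hm).symm]
  have hLle : Monotone L := monotone_nat_of_le_succ hLmono
  have hstab : ∀ k j, k ≤ j → ∀ m ∈ L k, Ψ j m = Ψ k m := fun k j hkj m hm => by
    induction j, hkj using Nat.le_induction with
    | base => rfl
    | succ j hkj ih => rw [hstep j m (hLle hkj hm), ih]
  have hex : ∀ m, ∃ k, m ∈ L k := fun m => by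
    obtain ⟨k, hk⟩ := E.exists_mem m
    exact ⟨k + 1, Or.inr hk⟩
  choose κ hκ using hex
  have hval : ∀ k, ∀ m ∈ L k, Ψ (κ m) m = Ψ k m := fun k m hm => by
    rcases le_total (κ m) k with h | h
    · exact (hstab _ _ h m (hκ m)).symm
    · exact hstab _ _ h m hm
  refine ⟨fun m => Ψ (κ m) m, ?_, fun m hm => hval 0 m hm, fun m hm => ?_⟩
  · rw [continuous_iff_continuousAt]
    intro m
    obtain ⟨k, hk⟩ := E.exists_mem m
    refine ((Ψ (k + 2)).continuous.continuousAt (x := m)).congr ?_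
    filter_upwards [isOpen_interior.mem_nhds (E.subset_interior_succ k hk)] with y hy
    exact (hval (k + 2) y (Or.inr (interior_subset hy))).symm
  · have : m = q (κ m) := (Ψ (κ m)).injective (hm.trans (hΨq _).symm)
    exact hCL (κ m) (by have := hqC (κ m); rwa [← ‹m = q (κ m)›] at this) (hκ m)

/-- The blow-up model of the Möbius band: pairs of a point of the closed unit disc and (the square
of the direction of) a real line through the origin containing it. -/
def blowup : Set (ℂ × ℂ) := {p | ‖p.2‖ = 1 ∧ ‖p.1‖ ≤ 1 ∧ p.1 ^ 2 = (‖p.1‖ : ℂ) ^ 2 * p.2}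

/-- The parametrisation of the blow-up by angle and signed radius. -/
def polar (q : ℝ × ℝ) : ℂ × ℂ := (q.2 * exp (Real.pi * q.1 * I), exp (2 * Real.pi * q.1 * I))

/-- The inverse of the blow-down map away from the exceptional circle. -/
def lineOf (z : ℂ) : ℂ × ℂ := (z, (z / ‖z‖) ^ 2)

theorem continuous_polar : Continuous polar := by
  unfold polar; fun_prop

theorem norm_polar_fst (q : ℝ × ℝ) : ‖(polar q).1‖ = |q.2| := by
  have : (Real.pi * q.1 * I : ℂ) = (Real.pi * q.1 : ℝ) * I := by push_cast; ring
  simp only [polar, norm_mul, norm_real, Real.norm_eq_abs]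
  rw [this, norm_exp_ofReal_mul_I, mul_one]

theorem polar_mem {q : ℝ × ℝ} (hq : |q.2| ≤ 1) : polar q ∈ blowup := by
  refine ⟨?_, by rwa [norm_polar_fst], ?_⟩
  · have : (2 * Real.pi * q.1 * I : ℂ) = (2 * Real.pi * q.1 : ℝ) * I := by push_cast; ring
    simp only [polar]
    rw [this, norm_exp_ofReal_mul_I]
  · rw [norm_polar_fst, ← ofReal_pow, sq_abs]
    simp only [polar, mul_pow, ← exp_nat_mul]
    push_cast
    ring_nf

theorem polar_eq_iff {a b : ℝ × ℝ} : polar a = polar b ↔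
    ∃ n : ℤ, a.1 = b.1 + n ∧ a.2 * (-1 : ℝ) ^ n = b.2 := by
  have hexp : ∀ (σ : ℝ) (n : ℤ), exp (Real.pi * (σ + n : ℝ) * I)
      = exp (Real.pi * σ * I) * ((-1 : ℝ) ^ n : ℝ) := fun σ n => by
    have : (Real.pi * (σ + n : ℝ) * I : ℂ) = Real.pi * σ * I + n * (Real.pi * I) := by
      push_cast; ring
    rw [this, exp_add, exp_int_mul, exp_pi_mul_I]
    push_cast; rfl
  have hsq : ∀ n : ℤ, ((-1 : ℝ) ^ n) * (-1 : ℝ) ^ n = 1 := fun n => by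
    rw [← mul_zpow]; simp
  constructor
  · intro h
    obtain ⟨h1, h2⟩ := Prod.ext_iff.1 h
    simp only [polar] at h1 h2
    obtain ⟨n, hn⟩ := exp_eq_exp_iff_exists_int.1 h2
    have hpi : (2 * Real.pi * I : ℂ) ≠ 0 := two_pi_I_ne_zero
    have hn' : (a.1 : ℂ) = b.1 + n := by
      have : (2 * Real.pi * I : ℂ) * a.1 = (2 * Real.pi * I : ℂ) * (b.1 + n) := by
        linear_combination hn
      exact mul_left_cancel₀ hpi this
    have hn2 : a.1 = b.1 + n := by exact_mod_cast hn'
    refine ⟨n, hn2, ?_⟩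
    rw [hn2, hexp, mul_comm (exp _), ← mul_assoc] at h1
    exact_mod_cast mul_right_cancel₀ (exp_ne_zero _) h1
  · rintro ⟨n, h1, h2⟩
    refine Prod.ext ?_ ?_
    · simp only [polar]
      rw [h1, hexp, ← h2]
      push_cast
      ring
    · simp only [polar]
      rw [h1]
      refine exp_eq_exp_iff_exists_int.2 ⟨n, ?_⟩
      push_cast; ring

theorem polar_inj {a b : ℝ × ℝ} (h : polar a = polar b) (hab : |a.1 - b.1| < 1) : a = b := by
  obtain ⟨n, h1, h2⟩ := polar_eq_iff.1 h
  have h3 : |(n : ℝ)| < 1 := by rwa [h1, add_sub_cancel_left] at hab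
  have h4 : n = 0 := by
    rw [← Int.cast_abs] at h3
    exact Int.abs_lt_one_iff.1 (by exact_mod_cast h3)
  subst h4
  exact Prod.ext (by simpa using h1) (by simpa using h2)

theorem exists_polar {p : ℂ × ℂ} (hp : p ∈ blowup) :
    ∃ q : ℝ × ℝ, polar q = p ∧ 0 ≤ q.1 ∧ q.1 ≤ 1 ∧ |q.2| = ‖p.1‖ := by
  obtain ⟨h1, h2, h3⟩ := hp
  obtain ⟨σ, hσ0, hσ1, hσ⟩ : ∃ σ : ℝ, 0 ≤ σ ∧ σ ≤ 1 ∧ exp (2 * Real.pi * σ * I) = p.2 := by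
    have hpi := Real.pi_pos
    have harg : exp (arg p.2 * I) = p.2 := by
      have := norm_mul_exp_arg_mul_I p.2
      rwa [h1, ofReal_one, one_mul] at this
    rcases le_or_gt 0 (arg p.2) with h | h
    · refine ⟨arg p.2 / (2 * Real.pi), by positivity, ?_, ?_⟩
      · rw [div_le_one (by positivity)]; linarith [arg_le_pi p.2]
      · conv_rhs => rw [← harg]
        congr 1
        have : (Real.pi : ℂ) ≠ 0 := by exact_mod_cast hpi.ne'
        push_cast; field_simp
    · refine ⟨arg p.2 / (2 * Real.pi) + 1, ?_, ?_, ?_⟩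
      · have := neg_pi_lt_arg p.2
        have : -1 ≤ arg p.2 / (2 * Real.pi) := by
          rw [le_div_iff₀ (by positivity)]; linarith
        linarith
      · have : arg p.2 / (2 * Real.pi) < 0 := div_neg_of_neg_of_pos h (by positivity)
        linarith
      · conv_rhs => rw [← harg]
        refine exp_eq_exp_iff_exists_int.2 ⟨1, ?_⟩
        have : (Real.pi : ℂ) ≠ 0 := by exact_mod_cast hpi.ne'
        push_cast; field_simp
  have h4 : p.1 ^ 2 = (‖p.1‖ * exp (Real.pi * σ * I)) ^ 2 := by
    rw [h3, ← hσ, mul_pow, ← exp_nat_mul]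
    push_cast; ring_nf
  rcases sq_eq_sq_iff_eq_or_eq_neg.1 h4 with h5 | h5
  · exact ⟨(σ, ‖p.1‖), Prod.ext h5.symm hσ, hσ0, hσ1, by simp⟩
  · refine ⟨(σ, -‖p.1‖), Prod.ext ?_ hσ, hσ0, hσ1, by simp⟩
    refine Eq.trans ?_ h5.symm
    simp only [polar, ofReal_neg, neg_mul]

theorem isCompact_blowup : IsCompact blowup := by
  refine (((isCompact_closedBall (0 : ℂ) 1).prod
    (isCompact_sphere (0 : ℂ) 1))).of_isClosed_subset ?_
    fun p hp => ⟨by simpa using hp.2.1, by simpa using hp.1⟩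
  have h1 : IsClosed {p : ℂ × ℂ | ‖p.2‖ = 1} := isClosed_eq (by fun_prop) (by fun_prop)
  have h2 : IsClosed {p : ℂ × ℂ | ‖p.1‖ ≤ 1} := isClosed_le (by fun_prop) (by fun_prop)
  have h3 : IsClosed {p : ℂ × ℂ | p.1 ^ 2 = (‖p.1‖ : ℂ) ^ 2 * p.2} :=
    isClosed_eq (by fun_prop) (by fun_prop)
  exact h1.inter (h2.inter h3)

theorem lineOf_mem {z : ℂ} (h0 : z ≠ 0) (h1 : ‖z‖ ≤ 1) : lineOf z ∈ blowup := by
  have : (‖z‖ : ℂ) ≠ 0 := by exact_mod_cast (norm_ne_zero_iff.2 h0)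
  refine ⟨?_, h1, ?_⟩
  · simp [lineOf, h0]
  · simp only [lineOf]
    field_simp

theorem eq_lineOf {p : ℂ × ℂ} (hp : p ∈ blowup) (h0 : p.1 ≠ 0) : p = lineOf p.1 := by
  have : (‖p.1‖ : ℂ) ≠ 0 := by exact_mod_cast (norm_ne_zero_iff.2 h0)
  refine Prod.ext rfl ?_
  simp only [lineOf, div_pow, hp.2.2]
  field_simp

theorem continuousOn_lineOf : ContinuousOn lineOf {z | z ≠ 0} := by
  unfold lineOf
  refine continuousOn_id.prodMk (ContinuousOn.pow (continuousOn_id.div (by fun_prop) ?_) 2)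
  intro z hz
  exact_mod_cast (norm_ne_zero_iff.2 hz)

theorem exists_homeomorph_blowup : Nonempty (MobiusBand ≃ₜ blowup) := by
  have hmem : ∀ t : unitInterval, |2 * (t : ℝ) - 1| ≤ 1 := fun t => by
    rw [abs_le]; constructor <;> linarith [t.2.1, t.2.2]
  let g : MobiusBand → blowup := Quot.lift
    (fun p : unitInterval × unitInterval => ⟨polar (p.1, 2 * p.2 - 1), polar_mem (hmem p.2)⟩) (by
      rintro a b ⟨h1, h2, h3⟩
      refine Subtype.ext (polar_eq_iff.2 ⟨-1, ?_, ?_⟩)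
      · simp [h1, h2]
      · simp [h3]; ring)
  have hg : Continuous g := continuous_quot_lift _
    ((continuous_polar.comp (by fun_prop)).subtype_mk _)
  have hrel : ∀ a b : unitInterval × unitInterval,
      polar (a.1, 2 * a.2 - 1) = polar (b.1, 2 * b.2 - 1) → (b.1 : ℝ) ≤ a.1 →
      (Quot.mk mobiusRel a : MobiusBand) = Quot.mk mobiusRel b := by
    intro a b h hle
    obtain ⟨n, h1, h2⟩ := polar_eq_iff.1 h
    simp only at h1 h2
    have hn0 : 0 ≤ n := by
      have : (0 : ℝ) ≤ n := by linarith
      exact_mod_cast this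
    have hn1 : n ≤ 1 := by
      have : (n : ℝ) ≤ 1 := by linarith [b.1.2.1, a.1.2.2]
      exact_mod_cast this
    obtain rfl | rfl : n = 0 ∨ n = 1 := by omega
    · congr 1
      refine Prod.ext (Subtype.ext (by simpa using h1)) (Subtype.ext ?_)
      simp at h2; linarith
    · refine (Quot.sound ⟨Subtype.ext ?_, Subtype.ext ?_, ?_⟩).symm
      · rw [Set.Icc.coe_zero]; push_cast at h1; linarith [b.1.2.1, a.1.2.2]
      · rw [Set.Icc.coe_one]; push_cast at h1; linarith [b.1.2.1, a.1.2.2]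
      · simp at h2; linarith
  have hginj : Function.Injective g := by
    intro x y
    refine Quot.induction_on₂ x y fun a b hab => ?_
    have hab' : polar (a.1, 2 * a.2 - 1) = polar (b.1, 2 * b.2 - 1) := congrArg Subtype.val hab
    rcases le_total (b.1 : ℝ) a.1 with h | h
    · exact hrel a b hab' h
    · exact (hrel b a hab'.symm h).symm
  have hgsurj : Function.Surjective g := by
    rintro ⟨p, hp⟩
    obtain ⟨q, hq, h0, h1, h2⟩ := exists_polar hp
    have h3 := abs_le.1 (h2.trans_le hp.2.1)
    refine ⟨Quot.mk _ (⟨q.1, h0, h1⟩, ⟨(q.2 + 1) / 2, by constructor <;> linarith⟩),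
      Subtype.ext ?_⟩
    change polar (q.1, 2 * ((q.2 + 1) / 2) - 1) = p
    rw [← hq]
    congr 1
    exact Prod.ext rfl (by simp; ring)
  have : CompactSpace MobiusBand := inferInstanceAs (CompactSpace (Quot mobiusRel))
  exact ⟨Continuous.homeoOfEquivCompactToT2 (f := Equiv.ofBijective g ⟨hginj, hgsurj⟩) hg⟩

section Surface

variable {M : Type*} [TopologicalSpace M]

theorem exists_blowup_param {A : Set M} (hA : Nonempty (A ≃ₜ MobiusBand)) :
    ∃ α : ℂ × ℂ → M, ContinuousOn α blowup ∧ InjOn α blowup ∧ α '' blowup = A := by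
  obtain ⟨e⟩ := hA
  obtain ⟨f⟩ := exists_homeomorph_blowup
  let g : blowup ≃ₜ A := f.symm.trans e.symm
  have : Nonempty M := ⟨g ⟨lineOf 1, lineOf_mem one_ne_zero (by simp)⟩⟩
  let α : ℂ × ℂ → M := Function.extend Subtype.val
    (fun p => (g p : M)) fun _ => Classical.arbitrary M
  have hα : blowup.domRestrict α = fun p => (g p : M) := by
    funext p
    rw [domRestrict_apply]
    exact Subtype.val_injective.extend_apply (fun p : blowup => (g p : M)) _ p
  refine ⟨α, ?_, ?_, ?_⟩
  · rw [continuousOn_iff_continuous_domRestrict, hα]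
    exact continuous_subtype_val.comp g.continuous
  · rw [injOn_iff_injective, hα]
    exact Subtype.val_injective.comp g.injective
  · rw [← range_domRestrict, hα]
    have : (fun p => (g p : M)) = Subtype.val ∘ g := rfl
    rw [this, range_comp, g.surjective.range_eq, image_univ, Subtype.range_coe]

theorem image_mem_nhds_of_injOn_prod [ChartedSpace (EuclideanHalfSpace 2) M] {G : ℝ × ℝ → M}
    {p : ℝ × ℝ} {N : Set (ℝ × ℝ)} (hN : N ∈ 𝓝 p) (hc : ContinuousOn G N) (hi : InjOn G N) :
    G '' N ∈ 𝓝 (G p) ∧ IsInner (G p) := by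
  let e : ℂ ≃ₜ ℝ × ℝ := Complex.equivRealProdCLM.toHomeomorph
  have hN' : e ⁻¹' N ∈ 𝓝 (e.symm p) := e.continuous.continuousAt.preimage_mem_nhds
    (by simpa using hN)
  have h1 : ContinuousOn (G ∘ e) (e ⁻¹' N) := hc.comp e.continuous.continuousOn fun _ h => h
  have h2 : InjOn (G ∘ e) (e ⁻¹' N) := fun a ha b hb hab => e.injective (hi ha hb hab)
  have h3 := image_mem_nhds_of_injOn hN' h1 h2
  have h4 := isInner_of_nhds hN' h1 h2
  rw [image_comp, e.image_preimage] at h3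
  simp only [Function.comp, e.apply_symm_apply] at h3 h4
  exact ⟨h3, h4⟩

variable [ChartedSpace (EuclideanHalfSpace 2) M] {α : ℂ × ℂ → M}

theorem image_polar_mem_nhds {O : Set (ℂ × ℂ)} (hO : IsOpen O) (hc : ContinuousOn α (blowup ∩ O))
    (hi : InjOn α (blowup ∩ O)) {q : ℝ × ℝ} (hq : |q.2| < 1) (hqO : polar q ∈ O)
    {N : Set (ℝ × ℝ)} (hN : N ∈ 𝓝 q) :
    (fun x => α (polar x)) '' N ∈ 𝓝 (α (polar q)) ∧ IsInner (α (polar q)) := by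
  let N' : Set (ℝ × ℝ) := N ∩ {x | |x.1 - q.1| < 1 / 2 ∧ |x.2| < 1} ∩ polar ⁻¹' O
  have hN' : N' ∈ 𝓝 q := by
    refine inter_mem (inter_mem hN (IsOpen.mem_nhds ?_ ?_))
      (continuous_polar.continuousAt.preimage_mem_nhds (hO.mem_nhds hqO))
    · have h1 : IsOpen {x : ℝ × ℝ | |x.1 - q.1| < 1 / 2} := isOpen_lt (by fun_prop) (by fun_prop)
      have h2 : IsOpen {x : ℝ × ℝ | |x.2| < 1} := isOpen_lt (by fun_prop) (by fun_prop)
      exact h1.inter h2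
    · exact ⟨by simp, hq⟩
  have hmem : ∀ x ∈ N', polar x ∈ blowup ∩ O := fun x hx => ⟨polar_mem hx.1.2.2.le, hx.2⟩
  have h := image_mem_nhds_of_injOn_prod hN' (G := fun x => α (polar x))
    (hc.comp continuous_polar.continuousOn hmem)
    (fun a ha b hb hab => polar_inj (hi (hmem a ha) (hmem b hb) hab) (by
        have h1 := abs_lt.1 ha.1.2.1
        have h2 := abs_lt.1 hb.1.2.1
        rw [abs_lt]; constructor <;> linarith))
  exact ⟨mem_of_superset h.1 (image_mono fun x hx => hx.1.1), h.2⟩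

/-- Invariance of domain for the open Möbius band. -/
theorem isOpen_image_blowup {O : Set (ℂ × ℂ)} (hO : IsOpen O) (hc : ContinuousOn α (blowup ∩ O))
    (hi : InjOn α (blowup ∩ O)) : IsOpen (α '' {p | p ∈ blowup ∩ O ∧ ‖p.1‖ < 1}) := by
  rw [isOpen_iff_mem_nhds]
  rintro _ ⟨p, ⟨⟨hp, hpO⟩, hp1⟩, rfl⟩
  obtain ⟨q, rfl, -, -, hq⟩ := exists_polar hp
  rw [← hq] at hp1
  have hN : polar ⁻¹' O ∩ {x | |x.2| < 1} ∈ 𝓝 q :=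
    ((hO.preimage continuous_polar).inter (isOpen_lt (by fun_prop) continuous_const)).mem_nhds
      ⟨hpO, hp1⟩
  refine mem_of_superset (image_polar_mem_nhds hO hc hi hp1 hpO hN).1 ?_
  rintro _ ⟨x, hx, rfl⟩
  exact ⟨polar x, ⟨⟨polar_mem hx.2.le, hx.1⟩, by simpa [norm_polar_fst] using hx.2⟩, rfl⟩

theorem isInner_blowup {O : Set (ℂ × ℂ)} (hO : IsOpen O) (hc : ContinuousOn α (blowup ∩ O))
    (hi : InjOn α (blowup ∩ O)) {p : ℂ × ℂ} (hp : p ∈ blowup ∩ O) (hp1 : ‖p.1‖ < 1) :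
    IsInner (α p) := by
  obtain ⟨q, rfl, -, -, hq⟩ := exists_polar hp.1
  rw [← hq] at hp1
  exact (image_polar_mem_nhds hO hc hi hp1 hp.2 univ_mem).2

end Surface

theorem isPreconnected_norm_mem {S : Set ℝ} (hS : S.OrdConnected) (h0 : ∀ r ∈ S, 0 ≤ r) (z₀ : ℂ) :
    IsPreconnected {z : ℂ | ‖z - z₀‖ ∈ S} := by
  have h1 : IsPreconnected (S ×ˢ (univ : Set ℝ)) := hS.isPreconnected.prod isPreconnected_univ
  convert h1.image (fun p : ℝ × ℝ => z₀ + p.1 * exp (p.2 * I)) (by fun_prop)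
  ext z
  constructor
  · intro hz
    exact ⟨(‖z - z₀‖, arg (z - z₀)), ⟨hz, mem_univ _⟩, by simp⟩
  · rintro ⟨p, ⟨hp, -⟩, rfl⟩
    simpa [norm_exp_ofReal_mul_I, abs_of_nonneg (h0 _ hp)] using hp

/-- The point of the blow-up at which the crosscap is attached. -/
def pole : ℂ × ℂ := lineOf (1 / 4)

/-- The blow-up with the attaching point of the crosscap removed. -/
def punctured : Set (ℂ × ℂ) := blowup ∩ {pole}ᶜ

/-- The exceptional circle of the blow-up. -/
def core : Set (ℂ × ℂ) := {p | p ∈ blowup ∧ p.1 = 0}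

theorem pole_mem : pole ∈ blowup := lineOf_mem (by norm_num) (by norm_num)

theorem isCompact_core : IsCompact core :=
  isCompact_blowup.inter_right (isClosed_eq continuous_fst continuous_const)

theorem mem_punctured {p : ℂ × ℂ} (hp : p ∈ blowup) (h : p.1 ≠ 1 / 4) : p ∈ punctured :=
  ⟨hp, fun (h' : p = pole) => h (by rw [h']; rfl)⟩

theorem lineOf_mem_punctured {z : ℂ} (h0 : z ≠ 0) (h1 : ‖z‖ ≤ 1) (h : z ≠ 1 / 4) :
    lineOf z ∈ punctured := mem_punctured (lineOf_mem h0 h1) h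

theorem fst_ne_of_mem_punctured {p : ℂ × ℂ} (hp : p ∈ punctured) : p.1 ≠ 1 / 4 := fun h =>
  hp.2 (show p = pole by rw [eq_lineOf hp.1 (by rw [h]; norm_num), h]; rfl)

/-- `ι` parametrises the complement of the core of a crosscap `β` inside a one-holed Klein bottle,
the puncture corresponding to the core. -/
structure IsCrosscap {M : Type*} [TopologicalSpace M] (β ι : ℂ × ℂ → M) : Prop where
  contB : ContinuousOn β blowup
  injB : InjOn β blowup
  cont : ContinuousOn ι punctured
  inj : InjOn ι punctured
  notMem_core : ∀ p ∈ punctured, ι p ∉ β '' core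
  exists_nhds : ∀ r > 0, ∃ O ∈ 𝓝 pole, ∀ p ∈ punctured, p ∈ O → ι p ∈ β ''
    {q | q ∈ blowup ∧ ‖q.1‖ < r}
  exists_radius : ∀ O ∈ 𝓝 pole, ∃ r > 0, r ≤ 1 ∧
    ∀ p ∈ blowup, p.1 ≠ 0 → ‖p.1‖ ≤ r → ∃ q ∈ punctured, q ∈ O ∧ ι q = β p

theorem exists_homeomorph_quarter : ∃ μ : ℂ ≃ₜ ℂ, μ (1 / 4) = 0 ∧ (∀ z, 1 / 2 ≤ ‖z‖ → μ z = z) ∧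
    ∀ z, ‖z‖ < 1 / 2 → ‖μ z‖ < 1 / 2 := by
  obtain ⟨t, h0, ht⟩ := exists_homeomorph_moveCenter (v := 1 / 2) (by norm_num)
  let d : ℂ ≃ₜ ℂ := Homeomorph.mulLeft₀ (2 : ℂ) two_ne_zero
  have hd : ∀ z, d z = 2 * z := fun z => rfl
  have hμ : ∀ z : ℂ, 1 / 2 ≤ ‖z‖ → ((d.trans t.symm).trans d.symm) z = z := fun z hz => by
    simp only [Homeomorph.trans_apply]
    rw [Homeomorph.symm_apply_eq, Homeomorph.symm_apply_eq, ht]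
    rw [hd, mem_ball_zero_iff, norm_mul, not_lt]
    norm_num
    linarith
  refine ⟨(d.trans t.symm).trans d.symm, ?_, hμ, fun z hz => ?_⟩
  · simp only [Homeomorph.trans_apply]
    rw [Homeomorph.symm_apply_eq, Homeomorph.symm_apply_eq, hd, hd, mul_zero, h0]
    norm_num
  · by_contra! h
    have := ((d.trans t.symm).trans d.symm).injective (hμ _ h)
    rw [this] at h
    exact absurd h (not_le.2 hz)

section
variable {M : Type*} [TopologicalSpace M] [T2Space M]

theorem isPreconnected_compl_core [ChartedSpace (EuclideanHalfSpace 2) M] [ConnectedSpace M]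
    {β : ℂ × ℂ → M} (hc : ContinuousOn β blowup) (hi : InjOn β blowup) :
    IsPreconnected (β '' core)ᶜ := by
  have hU := isOpen_image_blowup (α := β) isOpen_univ (hc.mono inter_subset_left)
    (hi.mono inter_subset_left)
  refine isPreconnected_compl_of_diff
    (isCompact_core.image_of_continuousOn (hc.mono fun p h => h.1)).isClosed hU ?_ ?_
  · rintro _ ⟨p, ⟨hp, h0⟩, rfl⟩
    exact ⟨p, ⟨⟨hp, mem_univ _⟩, by simp [h0]⟩, rfl⟩
  · have h1 := (isPreconnected_norm_mem (S := Ioo 0 1) ordConnected_Ioo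
      (fun r hr => hr.1.le) 0).image
      (fun z => β (lineOf z)) (hc.comp (continuousOn_lineOf.mono ?_) ?_)
    · convert h1 using 1
      ext m
      constructor
      · rintro ⟨⟨p, ⟨⟨hp, -⟩, h1⟩, rfl⟩, h2⟩
        have h0 : p.1 ≠ 0 := fun h0 => h2 ⟨p, ⟨hp, h0⟩, rfl⟩
        refine ⟨p.1, by simpa using ⟨h0, h1⟩, ?_⟩
        simp only [← eq_lineOf hp h0]
      · rintro ⟨z, hz, rfl⟩
        have hz' : 0 < ‖z‖ ∧ ‖z‖ < 1 := by simpa using hz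
        have hm := lineOf_mem (norm_pos_iff.1 hz'.1) hz'.2.le
        refine ⟨⟨_, ⟨⟨hm, mem_univ _⟩, hz'.2⟩, rfl⟩, ?_⟩
        rintro ⟨p, hp, hpz⟩
        have := hi hp.1 hm hpz
        exact norm_pos_iff.1 hz'.1 (by rw [← hp.2, this]; rfl)
    · intro z hz
      have hz' : 0 < ‖z‖ ∧ ‖z‖ < 1 := by simpa using hz
      exact norm_pos_iff.1 hz'.1
    · intro z hz
      have hz' : 0 < ‖z‖ ∧ ‖z‖ < 1 := by simpa using hz
      exact lineOf_mem (norm_pos_iff.1 hz'.1) hz'.2.le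

/-- Off the core and the point `β pole`, the crosscap `β` can be pushed into itself so that a
puncture at `β pole` opens up the core. -/
theorem exists_blowup_shift [ChartedSpace (EuclideanHalfSpace 2) M] {β : ℂ × ℂ → M}
    (hc : ContinuousOn β blowup) (hi : InjOn β blowup) {μ : ℂ ≃ₜ ℂ} (h0 : μ (1 / 4) = 0)
    (hμ : ∀ z, 1 / 2 ≤ ‖z‖ → μ z = z) (hμ' : ∀ z, ‖z‖ < 1 / 2 → ‖μ z‖ < 1 / 2) :
    ∃ φ : M → M, ContinuousOn φ (β '' core ∪ {β pole})ᶜ ∧ InjOn φ (β '' core ∪ {β pole})ᶜ ∧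
      (∀ m ∈ (β '' core ∪ {β pole})ᶜ, φ m ∉ β '' core) ∧
      ∀ z, z ≠ 0 → z ≠ 1 / 4 → ‖z‖ ≤ 1 → φ (β (lineOf z)) = β (lineOf (μ z)) := by
  have hne : ∀ z, z ≠ 1 / 4 → μ z ≠ 0 := fun z hz h => hz (μ.injective (h.trans h0.symm))
  have hle : ∀ z, ‖z‖ ≤ 1 → ‖μ z‖ ≤ 1 := fun z hz => by
    rcases lt_or_ge ‖z‖ (1 / 2) with h | h
    · linarith [hμ' z h]
    · rwa [hμ z h]
  have hD : ∀ p ∈ blowup, β p ∈ (β '' core ∪ {β pole})ᶜ → p.1 ≠ 0 ∧ p.1 ≠ 1 / 4 := fun p hp hm =>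
    have h : p.1 ≠ 0 := fun h => hm (Or.inl ⟨p, ⟨hp, h⟩, rfl⟩)
    ⟨h, fun h' => hm (Or.inr (by rw [eq_lineOf hp h, h']; rfl))⟩
  have hO : IsOpen (β '' {p | p ∈ blowup ∧ ‖p.1‖ < 1 / 2}) := by
    convert isOpen_image_blowup (α := β) (O := {p | ‖p.1‖ < 1 / 2})
      (isOpen_lt (by fun_prop) continuous_const) (hc.mono inter_subset_left)
      (hi.mono inter_subset_left) using 2
    ext p
    exact ⟨fun h => ⟨h, by have := h.2; linarith⟩, fun h => h.1⟩
  obtain ⟨φ, hφ, h1, h2⟩ := exists_continuousOn_glue (N := M) (K' :=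
    {p | p ∈ blowup ∧ p.1 ≠ 0 ∧ p.1 ≠ 1 / 4})
    (g := fun p => β (lineOf (μ p.1))) (h := id) (D := (β '' core ∪ {β pole})ᶜ)
    isCompact_blowup hc hi (fun p h => h.1) hO (fun p h => h.1) (fun p hp hm => ⟨hp, hD p hp hm⟩)
    (by
      refine hc.comp (continuousOn_lineOf.comp
        (by fun_prop) fun p hp => hne _ hp.2.2) fun p hp => ?_
      exact lineOf_mem (hne _ hp.2.2) (hle _ hp.1.2.1))
    continuousOn_id (by
      rintro p ⟨hp, hp0, -⟩ hpO
      rw [hμ _ (not_lt.1 fun h => hpO ⟨hp, h⟩), ← eq_lineOf hp hp0, id])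
  have key : ∀ m ∈ (β '' core ∪ {β pole})ᶜ, (∃ p ∈ blowup, p.1 ≠ 0 ∧ p.1 ≠ 1 / 4 ∧ ‖p.1‖ < 1 / 2 ∧
      m = β p ∧ φ m = β (lineOf (μ p.1)) ∧ φ m ∈ β '' {p | p ∈ blowup ∧ ‖p.1‖ < 1 / 2}) ∨
      (m ∉ β '' {p | p ∈ blowup ∧ ‖p.1‖ < 1 / 2} ∧ φ m = m) := by
    intro m hm
    by_cases h : m ∈ β '' {p | p ∈ blowup ∧ ‖p.1‖ < 1 / 2}
    · obtain ⟨p, ⟨hp, hp1⟩, rfl⟩ := h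
      obtain ⟨h3, h4⟩ := hD p hp hm
      refine Or.inl ⟨p, hp, h3, h4, hp1, rfl, h1 p ⟨hp, h3, h4⟩, ?_⟩
      rw [h1 p ⟨hp, h3, h4⟩]
      exact ⟨_, ⟨lineOf_mem (hne _ h4) (hle _ hp.2.1), hμ' _ hp1⟩, rfl⟩
    · exact Or.inr ⟨h, h2 m hm h⟩
  refine ⟨φ, hφ, ?_, ?_, ?_⟩
  · intro a ha b hb hab
    rcases key a ha with ⟨p, hp, hp0, hp4, -, rfl, hp5, hp6⟩ | ⟨ha1, ha2⟩ <;>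
    rcases key b hb with ⟨q, hq, hq0, hq4, -, rfl, hq5, hq6⟩ | ⟨hb1, hb2⟩
    · rw [hp5, hq5] at hab
      have := hi (lineOf_mem (hne _ hp4) (hle _ hp.2.1)) (lineOf_mem (hne _ hq4) (hle _ hq.2.1)) hab
      have := μ.injective (congrArg Prod.fst this)
      rw [eq_lineOf hp hp0, eq_lineOf hq hq0, this]
    · exact absurd (by rwa [hab, hb2] at hp6) hb1
    · exact absurd (by rwa [← hab, ha2] at hq6) ha1
    · rwa [ha2, hb2] at hab
  · intro m hm
    rcases key m hm with ⟨p, hp, hp0, hp4, -, rfl, hp5, hp6⟩ | ⟨-, h⟩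
    · rw [hp5]
      rintro ⟨q, hq, hqp⟩
      have := hi hq.1 (lineOf_mem (hne _ hp4) (hle _ hp.2.1)) hqp
      exact hne _ hp4 (by rw [← hq.2, this]; rfl)
    · rw [h]
      exact fun h => hm (Or.inl h)
  · intro z hz0 hz4 hz1
    exact h1 _ ⟨lineOf_mem hz0 hz1, hz0, hz4⟩

theorem exists_isCrosscap [ChartedSpace (EuclideanHalfSpace 2) M] [ConnectedSpace M] {A B : Set M}
    (hA : Nonempty (A ≃ₜ MobiusBand)) (hB : Nonempty (B ≃ₜ MobiusBand)) (hAB : Disjoint A B) :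
    ∃ β ι : ℂ × ℂ → M, IsCrosscap β ι := by
  obtain ⟨α, hαc, hαi, hαA⟩ := exists_blowup_param hA
  obtain ⟨β, hc, hi, hβB⟩ := exists_blowup_param hB
  obtain ⟨μ, h0, hμ, hμ'⟩ := exists_homeomorph_quarter
  have hZ : IsOpen (β '' core)ᶜ :=
    (isCompact_core.image_of_continuousOn (hc.mono fun p h => h.1)).isClosed.isOpen_compl
  have hαZ : ∀ p ∈ blowup, α p ∉ β '' core := by
    rintro p hp ⟨q, hq, h⟩
    exact disjoint_left.1 hAB (hαA ▸ mem_image_of_mem α hp) (hβB ▸ h ▸ mem_image_of_mem β hq.1)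
  have hβZ : β pole ∉ β '' core := by
    rintro ⟨q, hq, h⟩
    have := congrArg Prod.fst (hi hq.1 pole_mem h)
    rw [hq.2] at this
    norm_num [pole, lineOf] at this
  have hinner : ∀ {γ : ℂ × ℂ → M}, ContinuousOn γ blowup → InjOn γ blowup → IsInner (γ pole) :=
    fun h1 h2 => isInner_blowup isOpen_univ (h1.mono inter_subset_left) (h2.mono inter_subset_left)
      ⟨pole_mem, mem_univ _⟩ (by norm_num [pole, lineOf])
  obtain ⟨Φ, hΦ, hΦZ⟩ := exists_homeomorph_move hZ (isPreconnected_compl_core hc hi)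
    (hαZ _ pole_mem) hβZ
    (hinner hαc hαi) (hinner hc hi)
  obtain ⟨φ, hφc, hφi, hφZ, hφ⟩ := exists_blowup_shift hc hi h0 hμ hμ'
  have hmaps : ∀ p ∈ punctured, Φ (α p) ∈ (β '' core ∪ {β pole})ᶜ := by
    rintro p hp (h | h)
    · have := Φ.injective (hΦZ (Φ (α p)) fun h' => h' h)
      exact hαZ p hp.1 (this ▸ h)
    · have h' : Φ (α p) = Φ (α pole) := by rw [hΦ]; exact h
      exact hp.2 (hαi hp.1 pole_mem (Φ.injective h'))
  have hpole1 : ‖pole.1‖ < 1 := by norm_num [pole, lineOf]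
  refine ⟨β, fun p => φ (Φ (α p)), hc, hi, ?_, ?_, ?_, ?_, ?_⟩
  · exact hφc.comp (Φ.continuous.comp_continuousOn (hαc.mono inter_subset_left)) hmaps
  · intro p hp q hq h
    exact hαi hp.1 hq.1 (Φ.injective (hφi (hmaps p hp) (hmaps q hq) h))
  · exact fun p hp => hφZ _ (hmaps p hp)
  · intro r hr
    let N : Set (ℂ × ℂ) := {p | ‖μ p.1‖ < r ∧ p.1 ≠ 0}
    have hN : IsOpen N := IsOpen.inter
      (isOpen_lt (f := fun p : ℂ × ℂ => ‖μ p.1‖) (by fun_prop) continuous_const)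
      (isOpen_ne_fun (f := fun p : ℂ × ℂ => p.1) (by fun_prop) continuous_const)
    have hV := (isOpen_image_blowup (α := β) hN (hc.mono inter_subset_left)
      (hi.mono inter_subset_left))
    have hV' : Φ (α pole) ∈ β '' {p | p ∈ blowup ∩ N ∧ ‖p.1‖ < 1} := by
      rw [hΦ]
      refine ⟨pole, ⟨⟨pole_mem, ?_, ?_⟩, hpole1⟩, rfl⟩
      · rw [show pole.1 = 1 / 4 from rfl, h0, norm_zero]; exact hr
      · norm_num [pole, lineOf]
    have := (Φ.continuous.comp_continuousOn hαc) pole pole_mem (hV.mem_nhds hV')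
    obtain ⟨O, hO, hOV⟩ := mem_nhdsWithin_iff_exists_mem_nhds_inter.1 this
    refine ⟨O, hO, fun p hp hpO => ?_⟩
    obtain ⟨q, ⟨⟨hq, hqr, hq0⟩, hq1⟩, hqp⟩ := hOV ⟨hpO, hp.1⟩
    have hq4 : q.1 ≠ 1 / 4 := fun h => hmaps p hp (Or.inr (by
      change Φ (α p) = β pole
      rw [← show β q = Φ (α p) from hqp, eq_lineOf hq hq0, h]; rfl))
    refine ⟨lineOf (μ q.1), ⟨lineOf_mem (fun h => hq4 (μ.injective (h.trans h0.symm))) ?_, hqr⟩, ?_⟩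
    · rcases lt_or_ge ‖q.1‖ (1 / 2) with h | h
      · linarith [hμ' _ h]
      · rw [hμ _ h]; exact hq1.le
    · rw [← hφ q.1 hq0 hq4 hq1.le, ← eq_lineOf hq hq0, show β q = Φ (α p) from hqp]
  · intro O hO
    obtain ⟨O', hO'O, hO', hpO'⟩ := _root_.mem_nhds_iff.1 hO
    have hV := (isOpen_image_blowup (α := α) hO' (hαc.mono inter_subset_left)
      (hαi.mono inter_subset_left)).preimage Φ.symm.continuous
    have hV' : β (lineOf (μ.symm 0)) ∈ Φ.symm ⁻¹' (α '' {p | p ∈ blowup ∩ O' ∧ ‖p.1‖ < 1}) := by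
      rw [← h0, Homeomorph.symm_apply_apply, mem_preimage, ← show pole = lineOf
        (1 / 4) from rfl, ← hΦ,
        Homeomorph.symm_apply_apply]
      exact ⟨pole, ⟨⟨pole_mem, hpO'⟩, hpole1⟩, rfl⟩
    have hs0 : μ.symm 0 = 1 / 4 := by rw [← h0, Homeomorph.symm_apply_apply]
    have h1 : ContinuousOn (fun z => β (lineOf z)) {z | z ≠ 0 ∧ ‖z‖ < 1} :=
      hc.comp (continuousOn_lineOf.mono fun z hz => hz.1) fun z hz => lineOf_mem hz.1 hz.2.le
    have h2 : {z : ℂ | z ≠ 0 ∧ ‖z‖ < 1} ∈ 𝓝 (μ.symm 0) := by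
      refine ((isOpen_ne_fun continuous_id continuous_const).inter
        (isOpen_lt continuous_norm continuous_const)).mem_nhds ?_
      rw [hs0]
      norm_num
    have h3 : ContinuousAt (fun w => β (lineOf (μ.symm w))) 0 :=
      (h1.continuousAt h2).comp (f := μ.symm) (μ.symm.continuous.continuousAt)
    have h4 := (h3 (hV.mem_nhds hV'))
    obtain ⟨r, hr, hr'⟩ := Metric.mem_nhds_iff.1 (inter_mem h4 (μ.symm.continuous.continuousAt h2))
    refine ⟨min (r / 2) 1, by positivity, min_le_right _ _, fun p hp hp0 hpr => ?_⟩
    obtain ⟨⟨q, ⟨⟨hq, hqO⟩, hq1⟩, hqz⟩, hz0, hz1⟩ := hr' (show p.1 ∈ ball 0 r by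
      rw [mem_ball_zero_iff]
      linarith [min_le_left (r / 2) 1])
    have hz4 : μ.symm p.1 ≠ 1 / 4 := fun h => hp0 (by rw [← h0, ← h, Homeomorph.apply_symm_apply])
    have hqΦ : Φ (α q) = β (lineOf (μ.symm p.1)) := by
      rw [hqz, Homeomorph.apply_symm_apply]
    refine ⟨q, ⟨hq, fun h => hz4 ?_⟩, hO'O hqO, ?_⟩
    · rw [show q = pole from h, hΦ] at hqΦ
      exact (congrArg Prod.fst (hi pole_mem (lineOf_mem hz0 hz1.le) hqΦ)).symm
    · rw [hqΦ, hφ _ hz0 hz4 hz1.le, Homeomorph.apply_symm_apply, ← eq_lineOf hp hp0]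

end

/-- The map of the unit circle to itself which is constant on the right half and wraps the left
half. -/
def wrap (w : ℂ) : ℂ := w * exp (-(Real.arcsin w.im) * I)

theorem continuous_wrap : Continuous wrap := by
  unfold wrap
  have : Continuous fun w : ℂ => Real.arcsin w.im := Real.continuous_arcsin.comp continuous_im
  fun_prop

theorem norm_wrap {w : ℂ} (hw : ‖w‖ = 1) : ‖wrap w‖ = 1 := by
  rw [wrap, norm_mul, hw, one_mul, ← ofReal_neg, norm_exp_ofReal_mul_I]

theorem wrap_eq_one {w : ℂ} (hw : ‖w‖ = 1) (h : 0 ≤ w.re) : wrap w = 1 := by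
  have h1 : w.re * w.re + w.im * w.im = 1 := by
    rw [← normSq_apply, normSq_eq_norm_sq, hw, one_pow]
  have h2 : exp (Real.arcsin w.im * I) = w := by
    rw [exp_mul_I, ← ofReal_cos, ← ofReal_sin, Real.cos_arcsin, Real.sin_arcsin (by nlinarith)
      (by nlinarith),
      show 1 - w.im ^ 2 = w.re ^ 2 by linarith, Real.sqrt_sq h, re_add_im]
  calc wrap w = exp (Real.arcsin w.im * I) * exp (-(Real.arcsin w.im) * I) := by rw [wrap, h2]
    _ = 1 := by rw [← exp_add, neg_mul, add_neg_cancel, exp_zero]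

theorem isCompact_blowup_le (c : ℝ) : IsCompact {p | p ∈ blowup ∧ ‖p.1‖ ≤ c} :=
  isCompact_blowup.inter_right
    (isClosed_le (f := fun p : ℂ × ℂ => ‖p.1‖) (by fun_prop) continuous_const)

/-- A shift of the plane, trivial on the disc of radius `1 / 2`. -/
def shiftAmount (z : ℂ) : ℝ := max 0 (4 * ‖z‖ - 2)

/-- The direction of a line of the blow-up, modified near the boundary. -/
def direction (p : ℂ × ℂ) : ℂ :=
  if ‖p.1‖ ≤ 1 / 2 then p.2 else ((p.1 + shiftAmount p.1) / ‖p.1 + shiftAmount p.1‖) ^ 2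

theorem add_shiftAmount_ne {z : ℂ} (hz : z ≠ -(2 / 3)) (h0 : z ≠ 0) : z + shiftAmount z ≠ 0 := by
  intro h
  have h1 : z = -(shiftAmount z : ℂ) := eq_neg_of_add_eq_zero_left h
  have h2 : ‖z‖ = shiftAmount z := by
    conv_lhs => rw [h1]
    rw [norm_neg, norm_real, Real.norm_of_nonneg (show 0 ≤ shiftAmount z from le_max_left _ _)]
  have h3 : 0 < ‖z‖ := norm_pos_iff.2 h0
  have h4 : ‖z‖ = 2 / 3 := by
    rcases max_choice 0 (4 * ‖z‖ - 2) with h | h <;> rw [shiftAmount, h] at h2 <;> linarith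
  rw [← h2, h4] at h1
  exact hz (by rw [h1]; norm_num)

theorem direction_eq {p : ℂ × ℂ} (hp : p ∈ blowup) (h : 1 / 2 ≤ ‖p.1‖) :
    direction p = ((p.1 + shiftAmount p.1) / ‖p.1 + shiftAmount p.1‖) ^ 2 := by
  unfold direction
  split_ifs with h'
  · have h1 := le_antisymm h' h
    have h2 : p.1 ≠ 0 := by
      rw [← norm_pos_iff, h1]; norm_num
    have h3 : shiftAmount p.1 = 0 := by rw [shiftAmount, h1]; norm_num
    rw [h3, ofReal_zero, add_zero]
    exact congrArg Prod.snd (eq_lineOf hp h2)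
  · rfl

theorem norm_direction {p : ℂ × ℂ} (hp : p ∈ blowup) (h : p.1 ≠ -(2 / 3)) : ‖direction p‖ = 1 := by
  rcases le_or_gt ‖p.1‖ (1 / 2) with h1 | h1
  · rw [direction, if_pos h1, hp.1]
  · rw [direction_eq hp h1.le]
    have : p.1 + shiftAmount p.1 ≠ 0 := add_shiftAmount_ne h (by rw [← norm_pos_iff]; linarith)
    simp [this]

theorem continuousOn_direction : ContinuousOn direction (blowup ∩ {p | p.1 ≠ -(2 / 3)}) := by
  refine continuousOn_of_closed_cover (C₁ := {p | ‖p.1‖ ≤ 1 / 2}) (C₂ := {p | 1 / 2 ≤ ‖p.1‖})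
    (isClosed_le (by fun_prop) continuous_const) (isClosed_le continuous_const (by fun_prop))
    (fun p _ => le_total ‖p.1‖ (1 / 2)) ?_ ?_
  · exact continuous_snd.continuousOn.congr fun p hp => if_pos hp.2
  · refine ContinuousOn.congr (f := fun p : ℂ × ℂ =>
      ((p.1 + shiftAmount p.1) / ‖p.1 + shiftAmount p.1‖) ^ 2) ?_
        fun p hp => direction_eq hp.1.1 hp.2
    have h1 : Continuous fun p : ℂ × ℂ => p.1 + shiftAmount p.1 := by
      unfold shiftAmount; fun_prop
    refine ContinuousOn.pow (h1.continuousOn.div (continuous_ofReal.comp h1.norm).continuousOn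
      fun p hp => ?_) 2
    refine ofReal_ne_zero.2 (norm_ne_zero_iff.2 ?_)
    refine add_shiftAmount_ne hp.1.2 fun h => ?_
    have : 1 / 2 ≤ ‖p.1‖ := hp.2
    rw [h] at this
    norm_num at this

theorem direction_re_nonneg {p : ℂ × ℂ} (hp : p ∈ blowup) (h : 4 / 5 ≤ ‖p.1‖) :
    0 ≤ (direction p).re := by
  have h1 : ‖p.1‖ ≤ 1 := hp.2.1
  rw [direction_eq hp (by linarith), div_pow, ← ofReal_pow, div_ofReal_re]
  refine div_nonneg ?_ (by positivity)
  have h2 : shiftAmount p.1 = 4 * ‖p.1‖ - 2 := max_eq_right (by linarith)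
  have h3 : p.1.re * p.1.re + p.1.im * p.1.im = ‖p.1‖ ^ 2 := by
    rw [← normSq_apply, normSq_eq_norm_sq]
  rw [h2, pow_two, mul_re, add_re, add_im, ofReal_re, ofReal_im]
  nlinarith [sq_nonneg (p.1.re + (4 * ‖p.1‖ - 2) / 2)]

section
variable {M : Type*} [TopologicalSpace M] {β ι : ℂ × ℂ → M}

/-- The part of the one-holed Klein bottle inside a collar of its boundary. -/
def body (β ι : ℂ × ℂ → M) : Set M := ι '' {p | p ∈ punctured ∧ ‖p.1‖ ≤ 1 / 2} ∪ β '' core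

theorem IsCrosscap.exists_radius_lt (hX : IsCrosscap β ι) {c : ℝ} (hc : 1 / 4 < c) :
    ∃ r > 0, ∀ p ∈ blowup, ‖p.1‖ ≤ r → β p ∈ ι '' {p | p ∈ punctured ∧ ‖p.1‖ < c} ∪ β '' core := by
  obtain ⟨r, hr, -, h⟩ := hX.exists_radius {p | ‖p.1‖ < c}
    ((isOpen_lt (by fun_prop) continuous_const).mem_nhds (by simpa [pole, lineOf] using hc))
  refine ⟨r, hr, fun p hp hpr => ?_⟩
  by_cases h0 : p.1 = 0
  · exact Or.inr ⟨p, ⟨hp, h0⟩, rfl⟩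
  · obtain ⟨q, hq, hqc, hqp⟩ := h p hp h0 hpr
    exact Or.inl ⟨q, ⟨hq, hqc⟩, hqp⟩

theorem IsCrosscap.notMem_body (hX : IsCrosscap β ι) {p : ℂ × ℂ} (hp : p ∈ punctured)
    (h : 1 / 2 < ‖p.1‖) : ι p ∉ body β ι := by
  rintro (⟨q, hq, hqp⟩ | hm)
  · rw [hX.inj hq.1 hp hqp] at hq
    exact absurd h (not_lt.2 hq.2)
  · exact hX.notMem_core p hp hm

theorem IsCrosscap.exists_radius_disc (hX : IsCrosscap β ι) : ∃ r > 0, r ≤ 1 ∧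
    ∀ p ∈ blowup, ‖p.1‖ ≤ r → p.1 ≠ 0 →
      ∃ z : ℂ, z ≠ 1 / 4 ∧ ‖z - 1 / 4‖ ≤ 1 / 8 ∧ ι (lineOf z) = β p := by
  obtain ⟨r, hr, hr1, h⟩ := hX.exists_radius {p | ‖p.1 - 1 / 4‖ < 1 / 8}
    ((isOpen_lt (by fun_prop) continuous_const).mem_nhds (by simp [pole, lineOf]))
  refine ⟨r, hr, hr1, fun p hp hpr hp0 => ?_⟩
  obtain ⟨q, hq, hqO, hqp⟩ := h p hp hp0 hpr
  have hqO' : ‖q.1 - 1 / 4‖ < 1 / 8 := hqO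
  have hq0 : q.1 ≠ 0 := fun h => by rw [h] at hqO'; norm_num at hqO'
  exact ⟨q.1, fst_ne_of_mem_punctured hq, hqO'.le, by rw [← eq_lineOf hq.1 hq0, hqp]⟩

theorem IsCrosscap.isCompact_body (hX : IsCrosscap β ι) : IsCompact (body β ι) := by
  obtain ⟨r, hr, h⟩ := hX.exists_radius_lt (c := 1 / 2) (by norm_num)
  obtain ⟨O, hO, hOr⟩ := hX.exists_nhds r hr
  have h1 := (isCompact_blowup_le (1 / 2)).diff (isOpen_interior (s := O))
  have h2 := isCompact_blowup_le r
  have h3 : ({p | p ∈ blowup ∧ ‖p.1‖ ≤ 1 / 2} \ interior O) ⊆ punctured := fun p hp =>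
    ⟨hp.1.1, fun h => hp.2 (by rw [show p = pole from h]; exact mem_interior_iff_mem_nhds.2 hO)⟩
  convert (h1.image_of_continuousOn (hX.cont.mono h3)).union
    (h2.image_of_continuousOn (hX.contB.mono fun p hp => hp.1)) using 1
  refine subset_antisymm ?_ (union_subset ?_ ?_)
  · rintro _ (⟨p, hp, rfl⟩ | ⟨p, hp, rfl⟩)
    · by_cases hpO : p ∈ O
      · obtain ⟨q, hq, hqp⟩ := hOr p hp.1 hpO
        exact Or.inr ⟨q, ⟨hq.1, hq.2.le⟩, hqp⟩
      · exact Or.inl ⟨p, ⟨⟨hp.1.1, hp.2⟩, fun h => hpO (interior_subset h)⟩, rfl⟩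
    · exact Or.inr ⟨p, ⟨hp.1, by rw [hp.2, norm_zero]; exact hr.le⟩, rfl⟩
  · rintro _ ⟨p, hp, rfl⟩
    exact Or.inl ⟨p, ⟨h3 hp, hp.1.2⟩, rfl⟩
  · rintro _ ⟨p, hp, rfl⟩
    rcases h p hp.1 hp.2 with ⟨q, hq, hqp⟩ | h
    · exact Or.inl ⟨q, ⟨hq.1, hq.2.le⟩, hqp⟩
    · exact Or.inr h

end

section
variable {M : Type*} [TopologicalSpace M] [ChartedSpace (EuclideanHalfSpace 2) M] {β ι : ℂ × ℂ → M}

theorem IsCrosscap.isOpen_image (hX : IsCrosscap β ι) {O : Set (ℂ × ℂ)} (hO : IsOpen O) :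
    IsOpen (ι '' {p | p ∈ punctured ∧ p ∈ O ∧ ‖p.1‖ < 1}) := by
  have hsub : blowup ∩ ({pole}ᶜ ∩ O) ⊆ punctured := fun p hp => ⟨hp.1, hp.2.1⟩
  convert isOpen_image_blowup (isOpen_compl_singleton.inter hO) (hX.cont.mono hsub)
    (hX.inj.mono hsub) using 2
  ext p
  exact ⟨fun ⟨h1, h2, h3⟩ => ⟨⟨h1.1, h1.2, h2⟩, h3⟩, fun ⟨h1, h2⟩ => ⟨⟨h1.1, h1.2.1⟩, h1.2.2, h2⟩⟩

variable [T2Space M]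

theorem IsCrosscap.isPreconnected_compl_body [ConnectedSpace M] (hX : IsCrosscap β ι) :
    IsPreconnected (body β ι)ᶜ := by
  obtain ⟨r, hr, h⟩ := hX.exists_radius_lt (c := 1) (by norm_num)
  let U : Set M := ι '' {p | p ∈ punctured ∧ p ∈ univ ∧ ‖p.1‖ < 1} ∪
    β '' {p | p ∈ blowup ∩ {p | ‖p.1‖ < r} ∧ ‖p.1‖ < 1}
  have hU : IsOpen U := (hX.isOpen_image isOpen_univ).union
    (isOpen_image_blowup (isOpen_lt (by fun_prop) continuous_const)
      (hX.contB.mono inter_subset_left) (hX.injB.mono inter_subset_left))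
  have hann : ∀ z : ℂ, z ∈ {z : ℂ | ‖z - 0‖ ∈ Ioo (1 / 2) 1} → z ≠ 0 ∧ lineOf z ∈ punctured := by
    intro z hz
    rw [mem_ofPred_eq, sub_zero] at hz
    have h0 : z ≠ 0 := by rw [← norm_pos_iff]; linarith [hz.1]
    refine ⟨h0, lineOf_mem_punctured h0 hz.2.le fun h => ?_⟩
    have := hz.1
    rw [h] at this
    norm_num at this
  refine isPreconnected_compl_of_diff hX.isCompact_body.isClosed hU ?_ ?_
  · rintro _ (⟨p, hp, rfl⟩ | ⟨p, hp, rfl⟩)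
    · exact Or.inl ⟨p, ⟨hp.1, mem_univ _, by linarith [hp.2]⟩, rfl⟩
    · exact Or.inr ⟨p, ⟨⟨hp.1, by simpa [hp.2] using hr⟩, by simp [hp.2]⟩, rfl⟩
  · have h1 := (isPreconnected_norm_mem (S := Ioo (1 / 2) 1) ordConnected_Ioo
      (fun r hr => by linarith [hr.1]) 0).image (fun z => ι (lineOf z))
      (hX.cont.comp (continuousOn_lineOf.mono fun z hz => (hann z hz).1) fun z hz => (hann z hz).2)
    convert h1 using 1
    ext m
    constructor
    · rintro ⟨hm, hmb⟩
      have key : ∀ p ∈ punctured, ‖p.1‖ < 1 → ι p ∉ body β ι →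
          ι p ∈ (fun z => ι (lineOf z)) '' {z : ℂ | ‖z - 0‖ ∈ Ioo (1 / 2) 1} := by
        intro p hp hp1 hpb
        have h2 : 1 / 2 < ‖p.1‖ := not_le.1 fun h' => hpb (Or.inl ⟨p, ⟨hp, h'⟩, rfl⟩)
        refine ⟨p.1, by simpa using ⟨by linarith, hp1⟩, ?_⟩
        simp only [← eq_lineOf hp.1 (show p.1 ≠ 0 by rw [← norm_pos_iff]; linarith)]
      rcases hm with ⟨p, hp, rfl⟩ | ⟨p, hp, rfl⟩
      · exact key p hp.1 hp.2.2 hmb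
      · rcases h p hp.1.1 (le_of_lt hp.1.2) with ⟨q, hq, hqp⟩ | hc
        · rw [← hqp] at hmb ⊢
          exact key q hq.1 hq.2 hmb
        · exact absurd (Or.inr hc) hmb
    · rintro ⟨z, hz, rfl⟩
      have h2 := (hann z hz).2
      rw [mem_ofPred_eq, sub_zero] at hz
      exact ⟨Or.inl ⟨_, ⟨h2, mem_univ _, hz.2⟩, rfl⟩, hX.notMem_body h2 hz.1⟩

theorem IsCrosscap.exists_circleMap_compl (hX : IsCrosscap β ι) :
    ∃ φ : M → ℂ, ContinuousOn φ {ι (lineOf (-(2 / 3)))}ᶜ ∧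
      (∀ p ∈ punctured, p.1 ≠ -(2 / 3) → φ (ι p) = wrap (direction p)) ∧
      ∀ m, m ∉ ι '' punctured → φ m = 1 := by
  let K : Set (ℂ × ℂ) := blowup ∩ ({p | ‖p.1‖ ≤ 4 / 5} ∩ ({p | p.2.re ≤ 0} ∪ {p | 1 / 2 ≤ ‖p.1‖}))
  let O : Set (ℂ × ℂ) := {p | p ∈ punctured ∧
    p ∈ {p : ℂ × ℂ | ‖p.1‖ < 4 / 5} ∩ ({p | p.2.re < 0} ∪ {p | 1 / 2 < ‖p.1‖}) ∧ ‖p.1‖ < 1}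
  have hK : IsCompact K := isCompact_blowup.inter_right
    ((isClosed_le (by fun_prop) continuous_const).inter
      ((isClosed_le (by fun_prop) continuous_const).union (isClosed_le continuous_const
        (by fun_prop))))
  have hKp : K ⊆ punctured := by
    rintro p ⟨hp, -, h⟩
    refine mem_punctured hp fun h' => ?_
    have hp' : p = pole := by rw [eq_lineOf hp (by rw [h']; norm_num), h']; rfl
    rcases h with h | h
    · norm_num [hp', pole, lineOf] at h
    · norm_num [h'] at h
  have hO : IsOpen (ι '' O) := hX.isOpen_image
    ((isOpen_lt (by fun_prop) continuous_const).inter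
      ((isOpen_lt (by fun_prop) continuous_const).union (isOpen_lt continuous_const (by fun_prop))))
  have hOK : O ⊆ K := fun p hp => ⟨hp.1.1, show ‖p.1‖ ≤ 4 / 5 from le_of_lt hp.2.1.1,
    hp.2.1.2.elim (fun h => Or.inl (show p.2.re ≤ 0 from le_of_lt h))
      fun h => Or.inr (show 1 / 2 ≤ ‖p.1‖ from le_of_lt h)⟩
  have hone : ∀ p ∈ blowup, p.1 ≠ -(2 / 3) →
      ¬ (‖p.1‖ < 4 / 5 ∧ (p.2.re < 0 ∨ 1 / 2 < ‖p.1‖)) → wrap (direction p) = 1 := by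
    intro p hp h2 h
    refine wrap_eq_one (norm_direction hp h2) ?_
    rcases le_or_gt (4 / 5) ‖p.1‖ with h3 | h3
    · exact direction_re_nonneg hp h3
    · have h4 : ¬ (p.2.re < 0 ∨ 1 / 2 < ‖p.1‖) := fun h4 => h ⟨h3, h4⟩
      push Not at h4
      rw [direction, if_pos h4.2]
      exact h4.1
  have hD : ∀ p ∈ blowup, p.1 = -(2 / 3) → p = lineOf (-(2 / 3)) := fun p hp h => by
    rw [eq_lineOf hp (by rw [h]; norm_num), h]
  obtain ⟨φ, h1, h2, h3⟩ := exists_continuousOn_glue (N := ℂ) (K' := {p | p ∈ K ∧ p.1 ≠ -(2 / 3)})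
    (g := fun p => wrap (direction p)) (h := fun _ => 1) (D := {ι (lineOf (-(2 / 3)))}ᶜ) hK
    (hX.cont.mono hKp) (hX.inj.mono hKp) (fun p hp => hp.1) hO hOK
    (fun p hp h => ⟨hp, fun h' => h (by rw [hD p hp.1 h']; rfl)⟩)
    (continuous_wrap.comp_continuousOn (continuousOn_direction.mono fun p hp => ⟨hp.1.1, hp.2⟩))
    continuousOn_const (fun p hp hpO => hone p hp.1.1 hp.2 fun h =>
      hpO ⟨hKp hp.1, h, by linarith [h.1]⟩)
  have h23 : lineOf (-(2 / 3)) ∈ punctured := by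
    refine lineOf_mem_punctured ?_ ?_ ?_ <;> norm_num
  refine ⟨φ, h1, fun p hp h => ?_, fun m hm => ?_⟩
  · by_cases hpK : p ∈ K
    · exact h2 p ⟨hpK, h⟩
    · have hpO : ι p ∉ ι '' O := by
        rintro ⟨q, hq, hqp⟩
        exact hpK (hX.inj hq.1 hp hqp ▸ hOK hq)
      rw [h3 _ _ hpO]
      · exact (hone p hp.1 h fun h' => hpK ⟨hp.1, h'.1.le, h'.2.imp le_of_lt le_of_lt⟩).symm
      · intro h'
        exact h (congrArg Prod.fst (hX.inj hp h23 h'))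
  · refine h3 m ?_ fun h => hm (image_mono (fun p hp => hp.1) h)
    rintro rfl
    exact hm ⟨_, h23, rfl⟩

theorem IsCrosscap.exists_circleMap [SigmaCompactSpace M] [ConnectedSpace M]
    (hnc : ¬ CompactSpace M)
    (hX : IsCrosscap β ι) : ∃ f : M → ℂ, Continuous f ∧ (∀ m, ‖f m‖ = 1) ∧
      ∀ p ∈ punctured, ‖p.1‖ ≤ 1 / 2 → f (ι p) = wrap p.2 := by
  obtain ⟨φ, h1, h2, h3⟩ := hX.exists_circleMap_compl
  have h23 : lineOf (-(2 / 3)) ∈ punctured := by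
    refine lineOf_mem_punctured ?_ ?_ ?_ <;> norm_num
  have hn : ‖(lineOf (-(2 / 3))).1‖ = 2 / 3 := by norm_num [lineOf]
  obtain ⟨Ψ, hΨ, hΨK, hΨx⟩ := exists_continuous_avoid hnc hX.isCompact_body
    hX.isPreconnected_compl_body
    (hX.notMem_body h23 (by rw [hn]; norm_num))
    (isInner_blowup isOpen_compl_singleton hX.cont hX.inj h23 (by rw [hn]; norm_num))
  refine ⟨φ ∘ Ψ, h1.comp_continuous hΨ hΨx, fun m => ?_, fun p hp hp1 => ?_⟩
  · by_cases hm : Ψ m ∈ ι '' punctured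
    · obtain ⟨p, hp, hpm⟩ := hm
      have hp2 : p.1 ≠ -(2 / 3) := fun h => hΨx m (by
        rw [← hpm, eq_lineOf hp.1 (by rw [h]; norm_num), h])
      rw [Function.comp_apply, ← hpm, h2 p hp hp2, norm_wrap (norm_direction hp.1 hp2)]
    · rw [Function.comp_apply, h3 _ hm, norm_one]
  · rw [Function.comp_apply, hΨK _ (Or.inl ⟨p, ⟨hp, hp1⟩, rfl⟩), h2 p hp, direction, if_pos hp1]
    intro h
    rw [h] at hp1
    norm_num at hp1

end

/-- The rotation of the plane turning the circle of radius `r` by `e (θ r)`. -/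
def rotateBy (θ : ℝ → ℝ) (z : ℂ) : ℂ := z * exp (θ ‖z‖ * I)

theorem norm_rotateBy (θ : ℝ → ℝ) (z : ℂ) : ‖rotateBy θ z‖ = ‖z‖ := by
  rw [rotateBy, norm_mul, norm_exp_ofReal_mul_I, mul_one]

theorem rotateBy_rotateBy (θ η : ℝ → ℝ) (z : ℂ) :
    rotateBy θ (rotateBy η z) = rotateBy (fun r => θ r + η r) z := by
  rw [rotateBy, norm_rotateBy, rotateBy, rotateBy, mul_assoc, ← exp_add]
  congr 2
  push_cast
  ring

theorem exists_homeomorph_rotateBy {θ : ℝ → ℝ} (hθ : Continuous θ) :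
    ∃ t : ℂ ≃ₜ ℂ, ∀ z, t z = rotateBy θ z := by
  have hinv : ∀ θ η : ℝ → ℝ, (∀ r, θ r + η r = 0) → ∀ z, rotateBy θ (rotateBy η z) = z :=
    fun θ η h z => by
      rw [rotateBy_rotateBy, rotateBy, h, ofReal_zero, zero_mul, exp_zero, mul_one]
  have hc : ∀ η : ℝ → ℝ, Continuous η → Continuous (rotateBy η) := fun η h => by
    unfold rotateBy; fun_prop
  exact
    ⟨⟨⟨rotateBy θ, rotateBy fun r => -θ r, hinv _ _ fun r => by ring, hinv _ _ fun r => by ring⟩,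
    hc _ hθ, hc _ hθ.neg⟩, fun z => rfl⟩

/-- The angle of the Dehn twist supported on the annulus `3 / 8 ≤ ‖z‖ ≤ 1 / 2`. -/
def twistAngle (r : ℝ) : ℝ := 2 * Real.pi * max 0 (min 1 (4 - 8 * r))

theorem twistAngle_eq {r : ℝ} (h1 : 3 / 8 ≤ r) (h2 : r ≤ 1 / 2) :
    twistAngle r = 2 * Real.pi * (4 - 8 * r) := by
  rw [twistAngle, min_eq_right (by linarith), max_eq_right (by linarith)]

theorem rotateBy_twistAngle {z : ℂ} (h : ¬ (3 / 8 < ‖z‖ ∧ ‖z‖ < 1 / 2)) :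
    rotateBy twistAngle z = z := by
  rw [rotateBy, twistAngle]
  rcases le_or_gt ‖z‖ (3 / 8) with h1 | h1
  · rw [min_eq_left (by linarith), max_eq_right zero_le_one, mul_one]
    push_cast
    rw [exp_two_pi_mul_I, mul_one]
  · have h2 : 1 / 2 ≤ ‖z‖ := not_lt.1 fun h2 => h ⟨h1, h2⟩
    rw [min_eq_right (by linarith), max_eq_left (by linarith)]
    simp

theorem annulus_mem_punctured {z : ℂ} (h1 : 3 / 8 ≤ ‖z‖) (h2 : ‖z‖ ≤ 1) :
    z ≠ 0 ∧ lineOf z ∈ punctured := by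
  have h0 : z ≠ 0 := by rw [← norm_pos_iff]; linarith
  refine ⟨h0, lineOf_mem_punctured h0 h2 fun h => ?_⟩
  rw [h] at h1
  norm_num at h1

/-- The Dehn twist about a curve in the crosscap separating the puncture and the boundary. -/
theorem IsCrosscap.exists_twist {M : Type*} [TopologicalSpace M] [T2Space M]
    [ChartedSpace (EuclideanHalfSpace 2) M] {β ι : ℂ × ℂ → M} (hX : IsCrosscap β ι) :
    ∃ h ∈ Hc M, ∀ n : ℕ,
      (∀ z : ℂ, 3 / 8 ≤ ‖z‖ → ‖z‖ ≤ 1 / 2 →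
        hpow h n (ι (lineOf z)) = ι (lineOf (rotateBy (fun r => n * twistAngle r) z))) ∧
      ∀ m, m ∉ ι '' {p | p ∈ punctured ∧ 3 / 8 < ‖p.1‖ ∧ ‖p.1‖ < 1 / 2} → hpow h n m = m := by
  obtain ⟨t, ht⟩ := exists_homeomorph_rotateBy (θ := twistAngle) (by unfold twistAngle; fun_prop)
  let K : Set ℂ := {z | 3 / 8 ≤ ‖z‖ ∧ ‖z‖ ≤ 1 / 2}
  let O : Set ℂ := {z | 3 / 8 < ‖z‖ ∧ ‖z‖ < 1 / 2}
  have hK : IsCompact K := by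
    refine (isCompact_closedBall (0 : ℂ) (1 / 2)).of_isClosed_subset ?_
      fun z hz => by simpa using hz.2
    exact IsClosed.inter (isClosed_le continuous_const continuous_norm)
      (isClosed_le continuous_norm continuous_const)
  have hKp : ∀ z ∈ K, z ≠ 0 ∧ lineOf z ∈ punctured := fun z hz =>
    annulus_mem_punctured hz.1 (by linarith [hz.2])
  have hc : ContinuousOn (fun z => ι (lineOf z)) K :=
    hX.cont.comp (continuousOn_lineOf.mono fun z hz => (hKp z hz).1) fun z hz => (hKp z hz).2
  have hi : InjOn (fun z => ι (lineOf z)) K := fun a ha b hb h =>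
    congrArg Prod.fst (hX.inj (hKp a ha).2 (hKp b hb).2 h)
  have hOK : O ⊆ K := fun z hz => ⟨hz.1.le, hz.2.le⟩
  have himg :
    (fun z => ι (lineOf z)) '' O = ι '' {p | p ∈ punctured ∧ 3 / 8 < ‖p.1‖ ∧ ‖p.1‖ < 1 / 2} := by
    ext m
    constructor
    · rintro ⟨z, hz, rfl⟩
      exact ⟨_, ⟨(hKp z (hOK hz)).2, hz⟩, rfl⟩
    · rintro ⟨p, ⟨hp, hp1⟩, rfl⟩
      refine ⟨p.1, hp1, ?_⟩
      simp only [← eq_lineOf hp.1 (show p.1 ≠ 0 by rw [← norm_pos_iff]; linarith [hp1.1])]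
  have hO : IsOpen ((fun z => ι (lineOf z)) '' O) := by
    rw [himg]
    convert hX.isOpen_image (O := {p : ℂ × ℂ | 3 / 8 < ‖p.1‖} ∩ {p | ‖p.1‖ < 1 / 2})
      ((isOpen_lt continuous_const (by fun_prop)).inter
        (isOpen_lt (by fun_prop) continuous_const)) using 2
    ext p
    exact ⟨fun h => ⟨h.1, h.2, by have := h.2.2; linarith⟩, fun h => ⟨h.1, h.2.1⟩⟩
  obtain ⟨h, hF, hid⟩ := exists_homeomorph_extend hK hc hi hOK hO t fun z hz => by
    rw [ht]; exact rotateBy_twistAngle hz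
  refine ⟨h, ?_, fun n => ?_⟩
  · have hKi := hK.image_of_continuousOn hc
    refine hKi.of_isClosed_subset isClosed_closure
      (hKi.isClosed.closure_subset_iff.2 fun m hm => ?_)
    by_contra hmK
    exact hm (hid m fun h' => hmK (image_mono hOK h'))
  rw [← himg]
  induction n with
  | zero =>
    refine ⟨fun z _ _ => ?_, fun m _ => rfl⟩
    rw [rotateBy]
    simp [hpow]
  | succ n ih =>
    refine ⟨fun z h1 h2 => ?_, fun m hm => ?_⟩
    · rw [hpow, Homeomorph.trans_apply, ih.1 z h1 h2]
      have :=
        hF (rotateBy (fun r => n * twistAngle r) z) ⟨by rwa [norm_rotateBy], by rwa [norm_rotateBy]⟩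
      rw [this, ht, rotateBy_rotateBy]
      congr 3
      ext r
      push_cast
      ring
    · rw [hpow, Homeomorph.trans_apply, ih.2 m hm, hid m hm]

/-- The double cover of spanning unit vectors of a line field. -/
def fibre {M V : Type*} [Neg V] (s : M → V) : Set (M × V) := {x | x.2 = s x.1 ∨ x.2 = -s x.1}

section
variable {M : Type*} [TopologicalSpace M]

theorem exists_continuous_pos_tendsto [T2Space M] [SigmaCompactSpace M] [LocallyCompactSpace M] :
    ∃ ε : M → ℝ, Continuous ε ∧ (∀ m, 0 < ε m) ∧ (∀ m, ε m ≤ 1 / 2) ∧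
      ∀ c > 0, ∀ᶠ m in cocompact M, ε m ≤ c := by
  let E := CompactExhaustion.choice M
  obtain ⟨ε, hε⟩ := exists_continuous_forall_mem_convex_of_local_const (X := M) (E := ℝ)
    (t := fun m => Ioc 0 (1 / ((E.find m : ℝ) + 2))) (fun m => convex_Ioc _ _) fun x => by
      refine ⟨1 / (((E.find x + 1 : ℕ) : ℝ) + 2), ?_⟩
      filter_upwards [mem_interior_iff_mem_nhds.1 (E.subset_interior_succ _
        (E.mem_find x))] with m hm
      refine ⟨by positivity, one_div_le_one_div_of_le (by positivity) ?_⟩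
      have : E.find m ≤ E.find x + 1 := E.mem_iff_find_le.1 hm
      have : (E.find m : ℝ) ≤ ((E.find x + 1 : ℕ) : ℝ) := by exact_mod_cast this
      linarith
  refine ⟨ε, ε.continuous, fun m => (hε m).1, fun m => (hε m).2.trans ?_, fun c hc => ?_⟩
  · exact one_div_le_one_div_of_le (by norm_num) (by simp)
  · obtain ⟨n, hn⟩ := exists_nat_one_div_lt hc
    filter_upwards [(E.isCompact n).compl_mem_cocompact] with m hm
    have h1 : n < E.find m := not_le.1 fun h => hm (E.mem_iff_find_le.2 h)
    have h2 : (n : ℝ) < E.find m := by exact_mod_cast h1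
    exact (hε m).2.trans ((one_div_le_one_div_of_le (by positivity) (by linarith)).trans hn.le)

variable {V : Type*} [NormedAddCommGroup V] [InnerProductSpace ℝ V]

/-- The orthogonal projection onto the line spanned by a unit vector. -/
def proj (u : V) : V →L[ℝ] V := (innerSL ℝ u).smulRight u

theorem proj_apply (u w : V) : proj u w = (inner ℝ u w : ℝ) • u := rfl

theorem proj_neg (u : V) : proj (-u) = proj u := by
  ext w
  rw [proj_apply, proj_apply, inner_neg_left, smul_neg, neg_smul, neg_neg]

theorem continuous_proj : Continuous (proj : V → V →L[ℝ] V) := by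
  have : Continuous fun u : V => ContinuousLinearMap.smulRightL ℝ V V (innerSL ℝ u) u := by fun_prop
  exact this

/-- A function of a complex number and a real number, interpolating between the identity and complex
conjugation. -/
def conjBy (t : ℝ) (w : ℂ) : ℂ := w.re + t * w.im * I

theorem continuous_conjBy : Continuous fun x : ℝ × ℂ => conjBy x.1 x.2 := by
  unfold conjBy; fun_prop

theorem conjBy_one (w : ℂ) : conjBy 1 w = w := by
  rw [conjBy, ofReal_one, one_mul, re_add_im]

theorem conjBy_neg (t : ℝ) (w : ℂ) : conjBy (-t) w = (starRingEnd ℂ) (conjBy t w) := by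
  apply Complex.ext <;> simp [conjBy]

theorem conjBy_self_one (t : ℝ) : conjBy t 1 = 1 := by simp [conjBy]

theorem norm_conjBy {t : ℝ} {w : ℂ} (h : w = 1 ∨ t = 1 ∨ t = -1) : ‖conjBy t w‖ = ‖w‖ := by
  rcases h with rfl | rfl | rfl
  · rw [conjBy_self_one]
  · rw [conjBy_one]
  · rw [conjBy_neg, conjBy_one, norm_conj]

theorem norm_conjBy_sub {a b : ℝ} {w z : ℂ} (hw : w = 1 ∨ a = 1 ∨ a = -1)
    (hz : z = 1 ∨ b = 1 ∨ b = -1)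
    (hab : |a - b| < 2) : ‖conjBy a w - conjBy b z‖ = ‖w - z‖ := by
  have key : ∀ {w z : ℂ} {t : ℝ}, t = 1 ∨ t = -1 → ‖conjBy t w - conjBy t z‖ = ‖w - z‖ := by
    rintro w z t (rfl | rfl)
    · rw [conjBy_one, conjBy_one]
    · rw [conjBy_neg, conjBy_neg, conjBy_one, conjBy_one, ← map_sub, norm_conj]
  rcases hw with rfl | hw
  · rcases hz with rfl | hz
    · simp [conjBy_self_one]
    · have := key (w := 1) (z := z) hz
      rwa [conjBy_self_one] at this ⊢
  · rcases hz with rfl | hz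
    · have := key (w := w) (z := 1) hw
      rwa [conjBy_self_one] at this ⊢
    · have : a = b := by
        rcases hw with rfl | rfl <;> rcases hz with rfl | rfl <;> first | rfl | norm_num at hab
      rw [this, key hz]

/-- A line field on `M`, spanned by the unit vectors `s m`, and a circle-valued function, locally
trivial where the line field is not oriented by `l`. -/
structure LineField (s : M → V) (e : V) (l : V →L[ℝ] ℝ) (f : M → ℂ) : Prop where
  norm_s : ∀ m, ‖s m‖ = 1
  cont : Continuous fun m => proj (s m)
  eventually : ∀ᶠ m in cocompact M, s m = e
  norm_l : ‖l‖ ≤ 1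
  cont_f : Continuous f
  norm_f : ∀ m, ‖f m‖ = 1
  trivial : ∀ m, f m = 1 ∨ l (s m) = 1

/-- `g` lifts to the double cover `fibre s` by `ν`, and `δ` is the logarithm of the change of the
odd circle-valued function. -/
structure IsLift (s : M → V) (l : V →L[ℝ] ℝ) (f : M → ℂ) (g : M ≃ₜ M) (ν : M × V → V)
    (δ : M × V → ℂ) : Prop where
  cont_nu : ContinuousOn ν (fibre s)
  cont_delta : ContinuousOn δ (fibre s)
  mem : ∀ x ∈ fibre s, (g x.1, ν x) ∈ fibre s
  nu_neg : ∀ m v, (m, v) ∈ fibre s → ν (m, -v) = -ν (m, v)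
  delta_neg : ∀ m v, (m, v) ∈ fibre s → δ (m, -v) = -δ (m, v)
  exp_delta : ∀ x ∈ fibre s, conjBy (l (ν x)) (f (g x.1)) = conjBy (l x.2) (f x.1) * exp (δ x)
  eventually_nu : ∀ᶠ m in cocompact M, ∀ v, (m, v) ∈ fibre s → ν (m, v) = v
  eventually_delta : ∀ ε > 0, ∀ᶠ m in cocompact M, ∀ v, (m, v) ∈ fibre s → ‖δ (m, v)‖ ≤ ε

theorem isLift_refl (s : M → V) (l : V →L[ℝ] ℝ) (f : M → ℂ) :
    IsLift s l f (Homeomorph.refl M) Prod.snd fun _ => 0 where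
  cont_nu := continuous_snd.continuousOn
  cont_delta := continuousOn_const
  mem := fun _ hx => hx
  nu_neg := fun _ _ _ => rfl
  delta_neg := fun _ _ _ => neg_zero.symm
  exp_delta := fun x _ => by rw [exp_zero, mul_one]; rfl
  eventually_nu := Eventually.of_forall fun _ _ _ => rfl
  eventually_delta := fun ε hε => Eventually.of_forall fun _ _ _ => by rw [norm_zero]; exact hε.le

namespace LineField

variable {s : M → V} {e : V} {l : V →L[ℝ] ℝ} {f : M → ℂ}

theorem trivial_fibre (hL : LineField s e l f) {x : M × V} (hx : x ∈ fibre s) :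
    f x.1 = 1 ∨ l x.2 = 1 ∨ l x.2 = -1 := by
  refine (hL.trivial x.1).imp_right fun h => ?_
  rcases hx with hx | hx
  · exact Or.inl (by rw [hx, h])
  · exact Or.inr (by rw [hx, map_neg, h])

theorem norm_conjBy_fibre (hL : LineField s e l f) {x : M × V} (hx : x ∈ fibre s) :
    ‖conjBy (l x.2) (f x.1)‖ = 1 := by
  rw [norm_conjBy (hL.trivial_fibre hx), hL.norm_f]

theorem norm_fibre (hL : LineField s e l f) {x : M × V} (hx : x ∈ fibre s) : ‖x.2‖ = 1 := by
  rcases hx with hx | hx <;> simp [hx, hL.norm_s]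

theorem proj_fibre (hL : LineField s e l f) {x : M × V} (hx : x ∈ fibre s) :
    proj (s x.1) x.2 = x.2 := by
  have : proj (s x.1) (s x.1) = s x.1 := by
    rw [proj_apply, real_inner_self_eq_norm_sq, hL.norm_s, one_pow, one_smul]
  rcases hx with hx | hx
  · rw [hx, this]
  · rw [hx, map_neg, this]

/-- Transport of a unit vector to the line at a nearby point. -/
theorem transport (hL : LineField s e l f) {x : M × V} {y : M} (hx : x ∈ fibre s)
    (h : ‖proj (s y) - proj (s x.1)‖ < 1 / 8) :
    proj (s y) x.2 ≠ 0 ∧ (y, ‖proj (s y) x.2‖⁻¹ • proj (s y) x.2) ∈ fibre s ∧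
      |l (‖proj (s y) x.2‖⁻¹ • proj (s y) x.2) - l x.2| < 2 := by
  have h1 : ‖proj (s y) x.2 - x.2‖ ≤ 1 / 8 := by
    conv_lhs => rw [← hL.proj_fibre hx, hL.proj_fibre hx]
    have := (proj (s y) - proj (s x.1)).le_opNorm x.2
    rw [hL.norm_fibre hx, mul_one, sub_apply, hL.proj_fibre hx] at this
    linarith
  have h2 : 7 / 8 ≤ ‖proj (s y) x.2‖ := by
    have := norm_sub_norm_le x.2 (proj (s y) x.2)
    rw [hL.norm_fibre hx, norm_sub_rev] at this
    linarith
  have h3 : proj (s y) x.2 ≠ 0 := by rw [← norm_pos_iff]; linarith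
  refine ⟨h3, ?_, ?_⟩
  · have h4 : ‖proj (s y) x.2‖ = |inner ℝ (s y) x.2| := by
      rw [proj_apply, norm_smul, hL.norm_s, mul_one, Real.norm_eq_abs]
    rw [h4] at h2 ⊢
    rw [proj_apply, smul_smul]
    rcases abs_choice (inner ℝ (s y) x.2) with h5 | h5
    · rw [h5] at h2 ⊢
      exact Or.inl (by rw [inv_mul_cancel₀ (by linarith), one_smul])
    · rw [h5] at h2 ⊢
      refine Or.inr ?_
      rw [inv_neg, neg_mul, inv_mul_cancel₀ (by linarith), neg_smul, one_smul]
  · have hb : ∀ w : V, |l w| ≤ ‖w‖ := fun w =>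
      (l.le_opNorm w).trans (mul_le_of_le_one_left (norm_nonneg _) hL.norm_l)
    have h5 : |l (‖proj (s y) x.2‖⁻¹ • proj (s y) x.2)| ≤ 1 := by
      refine (hb _).trans ?_
      rw [norm_smul, norm_inv, norm_norm, inv_mul_cancel₀ (by linarith)]
    have h6 : |l (proj (s y) x.2) - l x.2| ≤ 1 / 8 := by
      rw [← map_sub]; exact (hb _).trans h1
    have h7 : |l (‖proj (s y) x.2‖⁻¹ • proj (s y) x.2) - l (proj (s y) x.2)| ≤ 1 / 8 := by
      set w := proj (s y) x.2
      have h8 : ‖w‖ ≤ 9 / 8 := by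
        have := norm_add_le (w - x.2) x.2
        rw [sub_add_cancel, hL.norm_fibre hx] at this
        linarith
      have h9 : l w = ‖w‖ * l (‖w‖⁻¹ • w) := by
        rw [map_smul, smul_eq_mul, ← mul_assoc, mul_inv_cancel₀ (by linarith), one_mul]
      rw [h9, show ∀ a b : ℝ, a - b * a = (1 - b) * a from fun a b => by ring, abs_mul]
      calc |1 - ‖w‖| * |l (‖w‖⁻¹ • w)| ≤ 1 / 8 * 1 :=
            mul_le_mul (abs_le.2 ⟨by linarith, by linarith⟩) h5 (abs_nonneg _) (by norm_num)
        _ = 1 / 8 := mul_one _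
    have := abs_sub_le (l (‖proj (s y) x.2‖⁻¹ • proj (s y) x.2)) (l (proj (s y) x.2)) (l x.2)
    linarith

end LineField

end

section
variable {M : Type*} [TopologicalSpace M] {V : Type*} [NormedAddCommGroup V] [InnerProductSpace ℝ V]
  {s : M → V} {e : V} {l : V →L[ℝ] ℝ} {f : M → ℂ}

/-- Lifts deform along small changes of the homeomorphism. -/
theorem IsLift.exists_of_close (hL : LineField s e l f) {ε : M → ℝ} (hε : ∀ m, ε m ≤ 1 / 2)
    (hε0 : ∀ c > 0, ∀ᶠ m in cocompact M, ε m ≤ c) {g g' : M ≃ₜ M} {ν : M × V → V} {δ : M × V → ℂ}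
    (hg : IsLift s l f g ν δ) (hP : ∀ m, ‖proj (s (g' m)) - proj (s (g m))‖ < 1 / 8)
    (hf : ∀ m, ‖f (g' m) - f (g m)‖ < ε m) : ∃ ν' δ', IsLift s l f g' ν' δ' := by
  let w : M × V → V := fun x => proj (s (g' x.1)) (ν x)
  let ν' : M × V → V := fun x => ‖w x‖⁻¹ • w x
  let R : M × V → ℂ := fun x => conjBy (l (ν' x)) (f (g' x.1)) / conjBy (l (ν x)) (f (g x.1))
  have ht : ∀ x ∈ fibre s, w x ≠ 0 ∧ (g' x.1, ν' x) ∈ fibre s ∧ |l (ν' x) - l (ν x)| < 2 :=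
    fun x hx => hL.transport (x := (g x.1, ν x)) (hg.mem x hx) (hP x.1)
  have hden : ∀ x ∈ fibre s, ‖conjBy (l (ν x)) (f (g x.1))‖ = 1 := fun x hx =>
    hL.norm_conjBy_fibre (hg.mem x hx)
  have hden0 : ∀ x ∈ fibre s, conjBy (l (ν x)) (f (g x.1)) ≠ 0 := fun x hx => by
    rw [← norm_ne_zero_iff, hden x hx]; exact one_ne_zero
  have hnum0 : ∀ x ∈ fibre s, conjBy (l (ν' x)) (f (g' x.1)) ≠ 0 := fun x hx => by
    rw [← norm_ne_zero_iff, hL.norm_conjBy_fibre (ht x hx).2.1]; exact one_ne_zero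
  have hR : ∀ x ∈ fibre s, ‖R x - 1‖ < ε x.1 := fun x hx => by
    rw [div_sub_one (hden0 x hx), norm_div, hden x hx, div_one,
      norm_conjBy_sub (hL.trivial_fibre (ht x hx).2.1) (hL.trivial_fibre (hg.mem x hx))
        (ht x hx).2.2]
    exact hf x.1
  have hRs : ∀ x ∈ fibre s, R x ∈ slitPlane := fun x hx => by
    have := mem_slitPlane_of_norm_lt_one (z := R x - 1) (by linarith [hR x hx, hε x.1])
    rwa [add_sub_cancel] at this
  have hw : ContinuousOn w (fibre s) :=
    ((hL.cont.comp (g'.continuous.comp continuous_fst)).continuousOn).clm_apply hg.cont_nu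
  have hν' : ContinuousOn ν' (fibre s) :=
    (hw.norm.inv₀ fun x hx => norm_ne_zero_iff.2 (ht x hx).1).smul hw
  have hRc : ContinuousOn R (fibre s) := by
    refine ContinuousOn.div ?_ ?_ hden0
    · exact continuous_conjBy.comp_continuousOn ((l.continuous.comp_continuousOn hν').prodMk
        (hL.cont_f.comp (g'.continuous.comp continuous_fst)).continuousOn)
    · exact continuous_conjBy.comp_continuousOn ((l.continuous.comp_continuousOn hg.cont_nu).prodMk
        (hL.cont_f.comp (g.continuous.comp continuous_fst)).continuousOn)
  have hνn : ∀ m v, (m, v) ∈ fibre s → ν' (m, -v) = -ν' (m, v) := fun m v hx => by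
    simp only [ν', w, hg.nu_neg m v hx, map_neg, norm_neg, smul_neg]
  refine ⟨ν', fun x => δ x + log (R x), hν', hg.cont_delta.add (hRc.clog hRs), fun x hx =>
    (ht x hx).2.1,
    hνn, ?_, ?_, ?_, ?_⟩
  · intro m v hx
    have hinv : ∀ {t : ℝ} {z : ℂ}, ‖conjBy t z‖ = 1 → conjBy (-t) z = (conjBy t z)⁻¹ :=
      fun {t z} h => by
      rw [conjBy_neg, Complex.inv_def, normSq_eq_norm_sq, h]
      simp
    have h1 : R (m, -v) = (R (m, v))⁻¹ := by
      simp only [R]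
      rw [hνn m v hx, hg.nu_neg m v hx, map_neg, map_neg, hinv (hden _ hx),
        hinv (hL.norm_conjBy_fibre (ht _ hx).2.1), inv_div_inv, inv_div]
    simp only [hg.delta_neg m v hx, h1]
    rw [log_inv _ (slitPlane_arg_ne_pi (hRs _ hx))]
    ring
  · intro x hx
    rw [exp_add, exp_log (slitPlane_ne_zero (hRs x hx)), ← mul_assoc, ← hg.exp_delta x hx,
      mul_div_cancel₀ _ (hden0 x hx)]
  · have hg' : Tendsto g' (cocompact M) (cocompact M) := g'.isClosedEmbedding.tendsto_cocompact
    filter_upwards [hg.eventually_nu, hL.eventually, hg'.eventually hL.eventually] with m h1 h2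
      h3 v hv
    have h4 : (g' m, v) ∈ fibre s := by
      simpa only [fibre, mem_ofPred_eq, h2, h3] using hv
    have h5 : w (m, v) = v := by
      simp only [w, h1 v hv]
      exact hL.proj_fibre h4
    have h6 : ‖v‖ = 1 := hL.norm_fibre hv
    simp only [ν', h5, h6, inv_one, one_smul]
  · intro c hc
    filter_upwards [hg.eventually_delta (c / 4) (by positivity), hε0 (c / 4) (by positivity)]
      with m h1 h2 v hv
    have h3 := hR _ hv
    have h4 := norm_log_one_add_half_le_self (z := R (m, v) - 1) (by linarith [hε m])
    rw [add_sub_cancel] at h4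
    have h5 := norm_add_le (δ (m, v)) (log (R (m, v)))
    have h6 := h1 v hv
    linarith

/-- Homeomorphisms in the identity component lift. -/
theorem exists_isLift_of_mem_H0 [T2Space M] [SigmaCompactSpace M] [LocallyCompactSpace M]
    (hL : LineField s e l f) {g : M ≃ₜ M} (hg : g ∈ H0 M) : ∃ ν δ, IsLift s l f g ν δ := by
  obtain ⟨ε, hεc, hεp, hε, hε0⟩ := exists_continuous_pos_tendsto (M := M)
  let N : (M ≃ₜ M) → Set (M ≃ₜ M) := fun g₀ => {g | ∀ m : M, (m, g m) ∈
    {x : M × M | ‖proj (s x.2) - proj (s (g₀ x.1))‖ < 1 / 8 ∧ ‖f x.2 - f (g₀ x.1)‖ < ε x.1}}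
  have hN : ∀ g₀, IsOpen (N g₀) := fun g₀ => by
    refine TopologicalSpace.GenerateOpen.basic _ ⟨_, IsOpen.inter ?_ ?_, rfl⟩
    · exact isOpen_lt (((hL.cont.comp continuous_snd).sub
        (hL.cont.comp (g₀.continuous.comp continuous_fst))).norm) continuous_const
    · exact isOpen_lt (((hL.cont_f.comp continuous_snd).sub
        (hL.cont_f.comp (g₀.continuous.comp continuous_fst))).norm) (hεc.comp continuous_fst)
  have hNg : ∀ g₀, N g₀ ∈ 𝓝 g₀ := fun g₀ => (hN g₀).mem_nhds fun m => by simpa using hεp m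
  let S : Set (M ≃ₜ M) := {g | ∃ ν δ, IsLift s l f g ν δ}
  have hS : IsClopen S := by
    constructor
    · rw [← isOpen_compl_iff, isOpen_iff_mem_nhds]
      refine fun g₀ h₀ => mem_of_superset (hNg g₀) fun g hg ⟨ν, δ, h⟩ => h₀ ?_
      exact h.exists_of_close hL hε hε0 (fun m => by rw [norm_sub_rev]; exact (hg m).1)
        fun m => by rw [norm_sub_rev]; exact (hg m).2
    · rw [isOpen_iff_mem_nhds]
      rintro g₀ ⟨ν, δ, h⟩
      exact mem_of_superset (hNg g₀) fun g hg =>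
        h.exists_of_close hL hε hε0 (fun m => (hg m).1) fun m => (hg m).2
  exact hS.connectedComponent_subset ⟨_, _, isLift_refl s l f⟩ hg

end

/-- The vector of `ℂ × ℝ` (with its Euclidean norm) with given coordinates. -/
def vec (c : ℂ) (a : ℝ) : WithLp 2 (ℂ × ℝ) := WithLp.toLp 2 (c, a)

/-- The real coordinate on `ℂ × ℝ`. -/
def height : WithLp 2 (ℂ × ℝ) →L[ℝ] ℝ := WithLp.sndL 2 ℝ ℂ ℝ

theorem height_vec (c : ℂ) (a : ℝ) : height (vec c a) = a := rfl

theorem norm_height_le : ‖height‖ ≤ 1 :=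
  ContinuousLinearMap.opNorm_le_bound _ zero_le_one fun x => by
    rw [one_mul]; exact WithLp.norm_snd_le _ x

theorem continuous_vec : Continuous fun x : ℂ × ℝ => vec x.1 x.2 :=
  WithLp.prod_continuous_toLp 2 ℂ ℝ

theorem neg_vec (c : ℂ) (a : ℝ) : -vec c a = vec (-c) (-a) := rfl

theorem norm_vec {w : ℂ} {a : ℝ} (hw : ‖w‖ = 1) (ha : |a| ≤ 1) :
    ‖vec (√(1 - a ^ 2) * w) a‖ = 1 := by
  have h : 0 ≤ 1 - a ^ 2 := sub_nonneg.2 ((sq_le_one_iff_abs_le_one a).2 ha)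
  rw [← sq_eq_sq₀ (norm_nonneg _) zero_le_one, WithLp.prod_norm_sq_eq_of_L2]
  change ‖(√(1 - a ^ 2) * w : ℂ)‖ ^ 2 + ‖a‖ ^ 2 = 1 ^ 2
  rw [norm_mul, hw, mul_one, norm_real, Real.norm_eq_abs, sq_abs, Real.sq_sqrt h, Real.norm_eq_abs,
    sq_abs]
  ring

/-- Truncation to the interval `[-1, 1]`. -/
def clamp (t : ℝ) : ℝ := max (-1) (min 1 t)

theorem continuous_clamp : Continuous clamp := by unfold clamp; fun_prop

theorem abs_clamp_le (t : ℝ) : |clamp t| ≤ 1 :=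
  abs_le.2 ⟨le_max_left _ _, max_le (by norm_num) (min_le_left _ _)⟩

theorem clamp_neg (t : ℝ) : clamp (-t) = -clamp t := by
  rw [clamp, clamp, ← min_neg_neg, ← max_neg_neg, neg_neg, max_min_distrib_left,
    max_eq_right (by norm_num : (-1 : ℝ) ≤ 1)]

theorem clamp_zero : clamp 0 = 0 := by norm_num [clamp]

theorem clamp_eq_one {t : ℝ} (h : 1 ≤ t) : clamp t = 1 := by
  rw [clamp, min_eq_left h]; norm_num

/-- A unit vector field in polar coordinates around the exceptional circle. -/
def frame (r : ℝ) (q : ℝ × ℝ) : WithLp 2 (ℂ × ℝ) :=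
  vec (√(1 - clamp (q.2 / r) ^ 2) * exp (Real.pi * q.1 * I)) (clamp (q.2 / r))

theorem continuous_frame (r : ℝ) : Continuous (frame r) := by
  have h := continuous_clamp
  refine continuous_vec.comp (Continuous.prodMk ?_ ?_) <;> fun_prop

theorem norm_frame (r : ℝ) (q : ℝ × ℝ) : ‖frame r q‖ = 1 :=
  norm_vec (by rw [← ofReal_mul, norm_exp_ofReal_mul_I]) (abs_clamp_le _)

/-- The field of `frame` as a function on the blow-up away from the exceptional circle. -/
def frameOf (r : ℝ) (p : ℂ × ℂ) : WithLp 2 (ℂ × ℝ) :=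
  vec (√(1 - clamp (‖p.1‖ / r) ^ 2) * (p.1 / ‖p.1‖)) (clamp (‖p.1‖ / r))

theorem norm_frameOf (r : ℝ) {p : ℂ × ℂ} (hp : p.1 ≠ 0) : ‖frameOf r p‖ = 1 :=
  norm_vec (by simp [hp]) (abs_clamp_le _)

theorem continuousOn_frameOf (r : ℝ) : ContinuousOn (frameOf r) {p | p.1 ≠ 0} := by
  have h := continuous_clamp
  refine continuous_vec.comp_continuousOn (ContinuousOn.prodMk ?_ (by fun_prop))
  refine ContinuousOn.mul (by fun_prop) (ContinuousOn.div (by fun_prop)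
    (by fun_prop) fun p hp => ?_)
  exact ofReal_ne_zero.2 (norm_ne_zero_iff.2 hp)

theorem frameOf_eq {r : ℝ} (hr : 0 < r) {p : ℂ × ℂ} (hp : r ≤ ‖p.1‖) : frameOf r p = vec 0 1 := by
  rw [frameOf, clamp_eq_one ((one_le_div hr).2 hp)]; simp

theorem frameOf_polar_of_pos (r : ℝ) {q : ℝ × ℝ} (hq : 0 < q.2) :
    frameOf r (polar q) = frame r q := by
  have h : (q.2 : ℂ) ≠ 0 := ofReal_ne_zero.2 hq.ne'
  rw [frameOf, norm_polar_fst, abs_of_pos hq, frame, polar]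
  dsimp only
  rw [mul_div_cancel_left₀ _ h]

theorem frameOf_polar_of_neg (r : ℝ) {q : ℝ × ℝ} (hq : q.2 < 0) :
    frameOf r (polar q) = -frame r q := by
  have h : (q.2 : ℂ) ≠ 0 := ofReal_ne_zero.2 hq.ne
  rw [frameOf, norm_polar_fst, abs_of_neg hq, frame, polar, neg_vec, neg_div, clamp_neg, neg_sq]
  dsimp only
  rw [ofReal_neg, div_neg, mul_div_cancel_left₀ _ h, mul_neg]

theorem frame_eq_or_neg (r : ℝ) {q q' : ℝ × ℝ} (hq : q.2 = 0) (hq' : q'.2 = 0)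
    (h : polar q = polar q') :
    frame r q' = frame r q ∨ frame r q' = -frame r q := by
  have h1 : exp (Real.pi * q'.1 * I) ^ 2 = exp (Real.pi * q.1 * I) ^ 2 := by
    rw [← exp_nat_mul, ← exp_nat_mul]
    have := congrArg Prod.snd h
    simp only [polar] at this
    convert this.symm using 2 <;> push_cast <;> ring
  rw [frame, frame, hq, hq', zero_div, clamp_zero, neg_vec]
  rcases sq_eq_sq_iff_eq_or_eq_neg.1 h1 with h2 | h2
  · left; rw [h2]
  · right; rw [h2, mul_neg, neg_zero]

section
variable {M : Type*} [TopologicalSpace M] [T2Space M] [ChartedSpace (EuclideanHalfSpace 2) M]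
  {β : ℂ × ℂ → M}

/-- The line field on `M` carried by a crosscap. -/
theorem exists_lineField (hc : ContinuousOn β blowup) (hi : InjOn β blowup) {r : ℝ} (hr : 0 < r)
    (hr1 : r ≤ 1) {f : M → ℂ} (hf : Continuous f) (hf1 : ∀ m, ‖f m‖ = 1)
    (hfβ : ∀ p ∈ blowup, ‖p.1‖ ≤ r → f (β p) = 1) :
    ∃ s : M → WithLp 2 (ℂ × ℝ), LineField s (vec 0 1) height f ∧ ContinuousOn s (β '' core)ᶜ ∧
      (∀ q : ℝ × ℝ, 0 < q.2 → q.2 ≤ 1 → s (β (polar q)) = frame r q) ∧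
      (∀ q : ℝ × ℝ, q.2 < 0 → -1 ≤ q.2 → s (β (polar q)) = -frame r q) ∧
      ∀ q : ℝ × ℝ, |q.2| ≤ 1 → (β (polar q), frame r q) ∈ fibre s := by
  classical
  have hO : IsOpen (β '' {p | p ∈ blowup ∧ ‖p.1‖ < r}) := by
    convert isOpen_image_blowup (O := {p : ℂ × ℂ | ‖p.1‖ < r})
      (isOpen_lt (by fun_prop) continuous_const)
      (hc.mono inter_subset_left) (hi.mono inter_subset_left) using 2
    ext p
    exact ⟨fun h => ⟨h, h.2.trans_le hr1⟩, fun h => h.1⟩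
  have hcl : IsClosed (β '' core) := (isCompact_core.image_of_continuousOn
    (hc.mono fun p h => h.1)).isClosed
  obtain ⟨φ, hφ, hφβ, hφe⟩ := exists_continuousOn_glue (N := WithLp 2 (ℂ × ℝ)) (F := β)
    (K := blowup) (K' := {p | p ∈ blowup ∧ p.1 ≠ 0}) (O := {p | p ∈ blowup ∧ ‖p.1‖ < r}) (D := (β '' core)ᶜ)
    (g := frameOf r) (h := fun _ => vec 0 1)
    isCompact_blowup hc hi (fun p h => h.1) hO (fun p h => h.1)
    (fun p hp h => ⟨hp, fun h0 => h ⟨p, ⟨hp, h0⟩, rfl⟩⟩)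
    ((continuousOn_frameOf r).mono fun p h => h.2) continuousOn_const
    (fun p hp h => frameOf_eq hr (not_lt.1 fun h' => h ⟨hp.1, h'⟩))
  have hex : ∀ m, m ∈ β '' core → ∃ q : ℝ × ℝ, q.2 = 0 ∧ β (polar q) = m := by
    rintro _ ⟨p, ⟨hp, h0⟩, rfl⟩
    obtain ⟨q, rfl, -, -, hq⟩ := exists_polar hp
    rw [h0, norm_zero, abs_eq_zero] at hq
    exact ⟨q, hq, rfl⟩
  let s : M → WithLp 2 (ℂ × ℝ) :=
    fun m => if h : m ∈ β '' core then frame r (hex m h).choose else φ m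
  have hs : ∀ m, m ∉ β '' core → s m = φ m := fun m hm => dif_neg hm
  have hsc : ContinuousOn s (β '' core)ᶜ := hφ.congr hs
  have hncore : ∀ q : ℝ × ℝ, |q.2| ≤ 1 → q.2 ≠ 0 → β (polar q) ∉ β '' core := by
    rintro q hq h0 ⟨p, hp, hpq⟩
    rw [hi hp.1 (polar_mem hq) hpq] at hp
    have := hp.2
    rw [← norm_eq_zero, norm_polar_fst, abs_eq_zero] at this
    exact h0 this
  have hsβ : ∀ q : ℝ × ℝ, |q.2| ≤ 1 → q.2 ≠ 0 → s (β (polar q)) = frameOf r (polar q) :=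
    fun q hq h0 => by
    rw [hs _ (hncore q hq h0)]
    refine hφβ _ ⟨polar_mem hq, ?_⟩
    rwa [← norm_ne_zero_iff, norm_polar_fst, ne_eq, abs_eq_zero]
  have hpos : ∀ q : ℝ × ℝ, 0 < q.2 → q.2 ≤ 1 → s (β (polar q)) = frame r q := fun q h h1 => by
    rw [hsβ q (by rwa [abs_of_pos h]) h.ne', frameOf_polar_of_pos r h]
  have hneg : ∀ q : ℝ × ℝ, q.2 < 0 → -1 ≤ q.2 → s (β (polar q)) = -frame r q := fun q h h1 => by
    rw [hsβ q (by rw [abs_of_neg h]; linarith) h.ne, frameOf_polar_of_neg r h]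
  have hfib : ∀ q : ℝ × ℝ, |q.2| ≤ 1 → (β (polar q), frame r q) ∈ fibre s := fun q hq => by
    rcases lt_trichotomy q.2 0 with h | h | h
    · right
      change frame r q = -s (β (polar q))
      rw [hneg q h (abs_le.1 hq).1, neg_neg]
    · have hm : β (polar q) ∈ β '' core := by
        refine ⟨polar q, ⟨polar_mem hq, ?_⟩, rfl⟩
        rw [← norm_eq_zero, norm_polar_fst, h, abs_zero]
      have hsm : s (β (polar q)) = frame r (hex _ hm).choose := dif_pos hm
      obtain ⟨h1, h2⟩ := (hex _ hm).choose_spec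
      have h3 := hi (polar_mem (by rw [h1, abs_zero]; exact zero_le_one)) (polar_mem hq) h2
      have := frame_eq_or_neg r h1 h h3
      rw [← hsm] at this
      exact this
    · exact Or.inl (hpos q h (abs_le.1 hq).2).symm
  have hproj : ∀ q : ℝ × ℝ, |q.2| ≤ 1 → proj (s (β (polar q))) = proj (frame r q) := fun q hq => by
    rcases hfib q hq with h | h <;> dsimp only at h <;> rw [h]
    rw [proj_neg]
  refine ⟨s, ⟨fun m => ?_, ?_, ?_, norm_height_le, hf, hf1, fun m => ?_⟩, hsc, hpos, hneg, hfib⟩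
  · by_cases hm : m ∈ β '' core
    · rw [show s m = frame r (hex m hm).choose from dif_pos hm, norm_frame]
    · rw [hs m hm]
      by_cases hmO : m ∈ β '' {p | p ∈ blowup ∧ ‖p.1‖ < r}
      · obtain ⟨p, hp, rfl⟩ := hmO
        have h0 : p.1 ≠ 0 := fun h0 => hm ⟨p, ⟨hp.1, h0⟩, rfl⟩
        rw [hφβ p ⟨hp.1, h0⟩, norm_frameOf r h0]
      · rw [hφe m hm hmO]
        simpa using norm_vec (w := 1) (a := 1) norm_one (by rw [abs_one])
  · rw [continuous_iff_continuousAt]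
    intro m
    by_cases hm : m ∈ β '' core
    · obtain ⟨q, hq, rfl⟩ := hex m hm
      intro W hW
      have hq1 : |q.2| < 1 := by rw [hq, abs_zero]; exact one_pos
      change W ∈ 𝓝 (proj (s (β (polar q)))) at hW
      rw [hproj q hq1.le] at hW
      have hN := (continuous_proj.comp (continuous_frame r)).continuousAt hW
      have hN' : {q : ℝ × ℝ | |q.2| < 1} ∈ 𝓝 q :=
        (isOpen_lt (f := fun q : ℝ × ℝ => |q.2|) (by fun_prop) continuous_const).mem_nhds hq1
      refine mem_map.2 (mem_of_superset (image_polar_mem_nhds isOpen_univ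
        (hc.mono inter_subset_left)
        (hi.mono inter_subset_left) hq1 (mem_univ _) (inter_mem hN hN')).1 ?_)
      rintro _ ⟨q', ⟨hq', hq1'⟩, rfl⟩
      rw [mem_preimage, hproj q' (le_of_lt hq1')]
      exact hq'
    · exact continuous_proj.continuousAt.comp (hsc.continuousAt (hcl.isOpen_compl.mem_nhds hm))
  · filter_upwards [(isCompact_blowup.image_of_continuousOn hc).compl_mem_cocompact] with m hm
    have h1 : m ∉ β '' core := fun ⟨p, hp, h⟩ => hm ⟨p, hp.1, h⟩
    rw [hs m h1, hφe m h1 fun ⟨p, hp, h⟩ => hm ⟨p, hp.1, h⟩]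
  · by_cases hmO : m ∈ β '' {p | p ∈ blowup ∧ ‖p.1‖ < r}
    · obtain ⟨p, hp, rfl⟩ := hmO
      exact Or.inl (hfβ p hp.1 hp.2.le)
    · have h1 : m ∉ β '' core := fun ⟨p, hp, h⟩ =>
        hmO ⟨p, ⟨hp.1, by rw [hp.2, norm_zero]; exact hr⟩, h⟩
      right
      rw [hs m h1, hφe m h1 hmO, height_vec]

end

theorem ne_zero_of_mem_disc {z : ℂ} (hz : ‖z - 1 / 4‖ ≤ 1 / 8) : z ≠ 0 := by
  rintro rfl
  norm_num at hz

theorem lineOf_mem_of_mem_disc {z : ℂ} (hz : ‖z - 1 / 4‖ ≤ 1 / 8) (hz' : z ≠ 1 / 4) :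
    lineOf z ∈ punctured ∧ ‖z‖ ≤ 3 / 8 := by
  have h : ‖z‖ ≤ 3 / 8 := by
    have := norm_add_le (z - 1 / 4) (1 / 4)
    rw [sub_add_cancel] at this
    norm_num at this hz ⊢
    linarith
  exact ⟨lineOf_mem_punctured (ne_zero_of_mem_disc hz) (by linarith) hz', h⟩

theorem circleMap_lineOf_eq_one {M : Type*} {ι : ℂ × ℂ → M} {f : M → ℂ}
    (hfι : ∀ p ∈ punctured, ‖p.1‖ ≤ 1 / 2 → f (ι p) = wrap p.2) {z : ℂ}
    (hz : ‖z - 1 / 4‖ ≤ 1 / 8) (hz' : z ≠ 1 / 4) : f (ι (lineOf z)) = 1 := by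
  obtain ⟨hp, h1⟩ := lineOf_mem_of_mem_disc hz hz'
  rw [hfι _ hp (h1.trans (by norm_num)), wrap_eq_one hp.1.1]
  have hre : |z.re - 1 / 4| ≤ 1 / 8 := by simpa using (abs_re_le_norm (z - 1 / 4)).trans hz
  have him : |z.im| ≤ 1 / 8 := by simpa using (abs_im_le_norm (z - 1 / 4)).trans hz
  rw [abs_le] at hre him
  rw [lineOf, div_pow, ← ofReal_pow, div_ofReal_re]
  refine div_nonneg ?_ (by positivity)
  rw [pow_two, mul_re]
  nlinarith

section
variable {M : Type*} [TopologicalSpace M] {β ι : ℂ × ℂ → M} {f : M → ℂ}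

theorem IsCrosscap.circleMap_eq_one (hX : IsCrosscap β ι) (hf : Continuous f)
    (hfι : ∀ p ∈ punctured, ‖p.1‖ ≤ 1 / 2 → f (ι p) = wrap p.2) {r : ℝ} (hr : 0 < r) (hr1 : r ≤ 1)
    (hβ : ∀ p ∈ blowup, ‖p.1‖ ≤ r → p.1 ≠ 0 →
      ∃ z : ℂ, z ≠ 1 / 4 ∧ ‖z - 1 / 4‖ ≤ 1 / 8 ∧ ι (lineOf z) = β p) {p : ℂ × ℂ} (hp : p ∈ blowup)
    (hpr : ‖p.1‖ ≤ r) : f (β p) = 1 := by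
  have hne : ∀ p ∈ blowup, ‖p.1‖ ≤ r → p.1 ≠ 0 → f (β p) = 1 := fun p hp hpr h0 => by
    obtain ⟨z, hz', hz, h⟩ := hβ p hp hpr h0
    rw [← h, circleMap_lineOf_eq_one hfι hz hz']
  by_cases h0 : p.1 = 0
  · obtain ⟨q, rfl, -, -, hq⟩ := exists_polar hp
    rw [h0, norm_zero, abs_eq_zero] at hq
    let γ : ℝ → ℂ := fun t => f (β (polar (q.1, t)))
    have hγ : ContinuousOn γ (Icc 0 r) := by
      refine hf.comp_continuousOn (hX.contB.comp
        (continuous_polar.comp (by fun_prop)).continuousOn ?_)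
      exact fun t ht => polar_mem (by rw [abs_of_nonneg ht.1]; exact ht.2.trans hr1)
    have hγ1 : EqOn γ (fun _ => 1) (Ioo 0 r) := fun t ht => by
      refine hne _ (polar_mem ?_) ?_ ?_
      · rw [abs_of_pos ht.1]; exact ht.2.le.trans hr1
      · rw [norm_polar_fst, abs_of_pos ht.1]; exact ht.2.le
      · rw [← norm_ne_zero_iff, norm_polar_fst, abs_of_pos ht.1]; exact ht.1.ne'
    have := hγ1.of_subset_closure hγ continuousOn_const Ioo_subset_Icc_self
      (by rw [closure_Ioo hr.ne]) (left_mem_Icc.2 hr.le)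
    rwa [show q = (q.1, 0) from Prod.ext rfl hq]
  · exact hne p hp hpr h0
end

theorem mem_fibre_self {M V : Type*} [Neg V] (s : M → V) (m : M) : (m, s m) ∈ fibre s := Or.inl rfl

theorem continuousOn_section {M V N : Type*} [TopologicalSpace M] [NormedAddCommGroup V]
    [TopologicalSpace N] {s : M → V} {Z : Set M} {F : M × V → N}
    (hF : ContinuousOn F (fibre s)) (hs : ContinuousOn s Z) : ContinuousOn
      (fun m => F (m, s m)) Z :=
  hF.comp (continuousOn_id.prodMk hs) fun m _ => mem_fibre_self s m

section
variable {M : Type*} [TopologicalSpace M] {V : Type*} [NormedAddCommGroup V] [InnerProductSpace ℝ V]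
  {s : M → V} {e : V} {l : V →L[ℝ] ℝ} {f : M → ℂ} {g : M ≃ₜ M} {ν : M × V → V} {δ : M × V → ℂ}
  {Z : Set M}

/-- A lift preserves a continuous section that is constant near infinity. -/
theorem IsLift.nu_section (hnc : ¬ CompactSpace M) (hL : LineField s e l f)
    (hg : IsLift s l f g ν δ)
    (hZ : IsCompact Z) (hZc : IsPreconnected Zᶜ) (hs : ContinuousOn s Zᶜ) (hgZ : MapsTo g Zᶜ Zᶜ)
    {m : M} (hm : m ∉ Z) : ν (m, s m) = s (g m) := by
  have hne : (cocompact M).NeBot := by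
    rw [cocompact_neBot_iff]; exact not_compactSpace_iff.1 hnc
  let u : M → ℝ := fun m => inner ℝ (ν (m, s m)) (s (g m))
  have hu : ContinuousOn u Zᶜ :=
    ContinuousOn.inner (continuousOn_section hg.cont_nu hs) (hs.comp g.continuous.continuousOn hgZ)
  have hmem : ∀ m, ν (m, s m) = s (g m) ∨ ν (m, s m) = -s (g m) := fun m =>
    hg.mem _ (mem_fibre_self s m)
  have hin : ∀ m, inner ℝ (s m) (s m) = (1 : ℝ) := fun m => by
    rw [real_inner_self_eq_norm_sq, hL.norm_s, one_pow]
  obtain ⟨m₀, ⟨⟨h1, h2⟩, h3⟩, h4⟩ :=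
    (((hL.eventually.and (g.isClosedEmbedding.tendsto_cocompact.eventually
    hL.eventually)).and hg.eventually_nu).and hZ.compl_mem_cocompact).exists
  have hu1 := hZc.eq_of_sq_eq hu (continuousOn_const (c := (1 : ℝ))) (fun m _ => by
    rcases hmem m with h | h <;> simp [u, h, hL.norm_s]) (fun _ => one_ne_zero) h4 (by
      simp only [u]
      rw [h3 _ (mem_fibre_self s m₀), h2, ← h1, hin])
  have := hu1 hm
  rcases hmem m with h | h
  · exact h
  · simp only [u] at this
    rw [h, inner_neg_left, hin] at this
    norm_num at this

theorem LineField.conjBy_section (hL : LineField s e l f) (m : M) :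
    conjBy (l (s m)) (f m) = f m := by
  rcases hL.trivial m with h | h
  · rw [h, conjBy_self_one]
  · rw [h, conjBy_one]

theorem IsLift.exp_delta_section (hL : LineField s e l f) (hg : IsLift s l f g ν δ) {m : M}
    (h : ν (m, s m) = s (g m)) : f (g m) = f m * exp (δ (m, s m)) := by
  have := hg.exp_delta _ (mem_fibre_self s m)
  dsimp only at this
  rwa [h, hL.conjBy_section, hL.conjBy_section] at this

theorem LineField.circleMap_ne_zero (hL : LineField s e l f) (m : M) : f m ≠ 0 := by
  rw [← norm_ne_zero_iff, hL.norm_f]; exact one_ne_zero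

theorem exp_delta_eq_one (hL : LineField s e l f) (hg : IsLift s l f g ν δ) {m : M}
    (h : ν (m, s m) = s (g m)) (hf : f (g m) = f m) : exp (δ (m, s m)) = 1 := by
  have := hg.exp_delta_section hL h
  rw [hf] at this
  exact (mul_right_eq_self₀.1 this.symm).resolve_right (hL.circleMap_ne_zero m)

theorem IsLift.delta_section_eq_zero (hnc : ¬ CompactSpace M) (hL : LineField s e l f)
    (hg : IsLift s l f g ν δ) {C : Set M} (hC : IsCompact C) (hCc : IsPreconnected Cᶜ)
    (hs : ContinuousOn s Cᶜ) (hν : ∀ m ∉ C, ν (m, s m) = s (g m)) (hgC : ∀ m ∉ C, g m = m) {m : M}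
    (hm : m ∉ C) : δ (m, s m) = 0 := by
  have hne : (cocompact M).NeBot := by
    rw [cocompact_neBot_iff]; exact not_compactSpace_iff.1 hnc
  rw [← norm_le_zero_iff]
  refine le_of_forall_pos_le_add fun ε hε => ?_
  obtain ⟨m', h1, h2⟩ := ((hg.eventually_delta ε hε).and hC.compl_mem_cocompact).exists
  rw [zero_add, eq_of_exp_eq_on (L :=
    fun m => δ (m, s m)) hCc (continuousOn_section hg.cont_delta hs)
    (fun m hm => exp_delta_eq_one hL hg (hν m hm) (by rw [hgC m hm])) hm h2]
  exact h1 _ (mem_fibre_self s m')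

end

theorem lineOf_rotateBy_snd {θ : ℝ → ℝ} {t : ℝ} (ht : 0 < t) :
    (lineOf (rotateBy θ t)).2 = exp (2 * θ t * I) := by
  have h : (t : ℂ) ≠ 0 := ofReal_ne_zero.2 ht.ne'
  rw [lineOf]
  dsimp only
  rw [norm_rotateBy, rotateBy, norm_real, Real.norm_of_nonneg ht.le, mul_div_cancel_left₀ _ h,
    ← exp_nat_mul]
  congr 1
  push_cast
  ring

section
variable {M : Type*} [TopologicalSpace M] {V : Type*} [NormedAddCommGroup V] [InnerProductSpace ℝ V]
  {s : M → V} {e : V} {l : V →L[ℝ] ℝ} {f : M → ℂ} {g : M ≃ₜ M} {ν : M × V → V} {δ : M × V → ℂ}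
  {β ι : ℂ × ℂ → M}

theorem IsCrosscap.apply_lineOf_notMem (hX : IsCrosscap β ι) {t : ℝ} (h : 3 / 8 ≤ t) (h1 : t ≤ 1) :
    ι (lineOf t) ∈ (β '' core)ᶜ := by
  have ht : ‖(t : ℂ)‖ = t := by rw [norm_real, Real.norm_of_nonneg (by linarith)]
  exact hX.notMem_core _ (annulus_mem_punctured (by rwa [ht]) (by rwa [ht])).2

/-- Along the annulus of the twist, the logarithm picks up the total angle of the twist. -/
theorem IsCrosscap.delta_twist (hX : IsCrosscap β ι) (hL : LineField s e l f)
    (hfι : ∀ p ∈ punctured, ‖p.1‖ ≤ 1 / 2 → f (ι p) = wrap p.2) (hs : ContinuousOn s (β '' core)ᶜ)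
    {n : ℕ} (hgι : ∀ z : ℂ, 3 / 8 ≤ ‖z‖ → ‖z‖ ≤ 1 / 2 →
      g (ι (lineOf z)) = ι (lineOf (rotateBy (fun r => n * twistAngle r) z)))
    (hg : IsLift s l f g ν δ) (hν : ∀ m ∉ β '' core, ν (m, s m) = s (g m))
    (h0 : ∀ m ∉ body β ι, δ (m, s m) = 0) :
    δ (ι (lineOf (3 / 8)), s (ι (lineOf (3 / 8)))) = 4 * Real.pi * n * I := by
  let D : ℝ → ℂ := fun t => δ (ι (lineOf t), s (ι (lineOf t)))
  have hnorm : ∀ t : ℝ, 3 / 8 ≤ t → ‖(t : ℂ)‖ = t := fun t ht => by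
    rw [norm_real, Real.norm_of_nonneg (by linarith)]
  have hpun : ∀ t : ℝ, 3 / 8 ≤ t → t ≤ 1 → lineOf t ∈ punctured := fun t h h1 =>
    (annulus_mem_punctured (by rwa [hnorm t h]) (by rwa [hnorm t h])).2
  have hD : ContinuousOn D (Icc (3 / 8) (3 / 4)) := by
    refine (continuousOn_section hg.cont_delta hs).comp (hX.cont.comp (continuousOn_lineOf.comp
      continuous_ofReal.continuousOn fun t ht => ?_) fun t ht => ?_) fun t ht => ?_
    · exact ofReal_ne_zero.2 (by linarith [ht.1])
    · exact hpun t ht.1 (by linarith [ht.2])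
    · exact hX.apply_lineOf_notMem ht.1 (by linarith [ht.2])
  have hD0 : EqOn D (fun _ => 0) (Ioo (1 / 2) (3 / 4)) := fun t ht =>
    h0 _ (hX.notMem_body (hpun t (by linarith [ht.1]) (by linarith [ht.2]))
      (by rw [lineOf, hnorm t (by linarith [ht.1])]; exact ht.1))
  have hDh : D (1 / 2) = 0 := by
    refine hD0.of_subset_closure (hD.mono (Icc_subset_Icc_left (by norm_num))) continuousOn_const
      Ioo_subset_Icc_self (by rw [closure_Ioo (by norm_num)]) (left_mem_Icc.2 (by norm_num))
  let w : ℝ → ℂ := fun t => exp (2 * (n * twistAngle t : ℝ) * I)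
  let L : ℝ → ℂ := fun t => 2 * (n * twistAngle t : ℝ) * I + -(Real.arcsin (w t).im) * I
  have htw : Continuous twistAngle := by unfold twistAngle; fun_prop
  have hL' : Continuous L := by
    have : Continuous fun t => Real.arcsin (w t).im := Real.continuous_arcsin.comp (by fun_prop)
    fun_prop
  have hexp : ∀ t ∈ Icc (3 / 8 : ℝ) (1 / 2), exp (D t - L t) = 1 := fun t ht => by
    have ht0 : 0 < t := by linarith [ht.1]
    have hn := hnorm t ht.1
    have h1 := hg.exp_delta_section hL (hν _ (hX.apply_lineOf_notMem ht.1 (by linarith [ht.2])))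
    have hr : ‖rotateBy (fun r => n * twistAngle r) (t : ℂ)‖ = t := by rw [norm_rotateBy, hn]
    rw [hgι t (by rw [hn]; exact ht.1) (by rw [hn]; exact ht.2),
      hfι _ (annulus_mem_punctured (by rw [hr]; exact ht.1) (by rw [hr]; linarith [ht.2])).2
        (by rw [lineOf, hr]; exact ht.2),
      hfι _ (hpun t ht.1 (by linarith [ht.2])) (by rw [lineOf, hn]; exact ht.2),
      lineOf_rotateBy_snd ht0, wrap_eq_one (w := (lineOf (t : ℂ)).2), one_mul, wrap,
        ← exp_add] at h1
    · rw [exp_sub, div_eq_one_iff_eq (exp_ne_zero _)]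
      exact h1.symm
    · exact (hpun t ht.1 (by linarith [ht.2])).1.1
    · rw [lineOf, hn, div_self (ofReal_ne_zero.2 ht0.ne')]; norm_num
  have hend : ∀ (t : ℝ) (k : ℕ), twistAngle t = 2 * Real.pi * k → L t = 4 * Real.pi *
    (n * k : ℕ) * I :=
    fun t k h => by
    have hw : w t = 1 := by
      simp only [w, h]
      rw [exp_eq_one_iff]
      refine ⟨2 * n * k, ?_⟩
      push_cast
      ring
    simp only [L, hw, one_im, Real.arcsin_zero, h]
    push_cast
    ring
  have key := eq_of_exp_eq_on (L := fun t => D t - L t) isPreconnected_Icc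
    ((hD.mono (Icc_subset_Icc_right (by norm_num))).sub hL'.continuousOn) hexp
    (left_mem_Icc.2 (by norm_num)) (right_mem_Icc.2 (by norm_num))
  rw [hDh, hend (1 / 2) 0 (by rw [twistAngle_eq (by norm_num) le_rfl]; norm_num),
    hend (3 / 8) 1 (by rw [twistAngle_eq le_rfl (by norm_num)]; norm_num)] at key
  have h38 : ((3 / 8 : ℝ) : ℂ) = 3 / 8 := by norm_num
  simp only [D, h38, mul_one, mul_zero, Nat.cast_zero, zero_mul, sub_zero] at key
  exact sub_eq_zero.1 key

end

section
variable {M : Type*} [TopologicalSpace M] {β ι : ℂ × ℂ → M} {h : M ≃ₜ M}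

theorem IsCrosscap.fixed_disc (hX : IsCrosscap β ι)
    (hh : ∀ m, m ∉ ι '' {p | p ∈ punctured ∧ 3 / 8 < ‖p.1‖ ∧ ‖p.1‖ < 1 / 2} → h m = m) {z : ℂ}
    (hz : ‖z - 1 / 4‖ ≤ 1 / 8) (hz' : z ≠ 1 / 4) : h (ι (lineOf z)) = ι (lineOf z) := by
  obtain ⟨hp, h1⟩ := lineOf_mem_of_mem_disc hz hz'
  refine hh _ ?_
  rintro ⟨p, hp', hpz⟩
  rw [hX.inj hp'.1 hp hpz] at hp'
  exact absurd h1 (not_le.2 hp'.2.1)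

theorem IsCrosscap.fixed_core (hX : IsCrosscap β ι)
    (hh : ∀ m, m ∉ ι '' {p | p ∈ punctured ∧ 3 / 8 < ‖p.1‖ ∧ ‖p.1‖ < 1 / 2} → h m = m) {m : M}
    (hm : m ∈ β '' core) : h m = m := by
  refine hh _ ?_
  rintro ⟨p, hp', rfl⟩
  exact hX.notMem_core p hp'.1 hm

theorem IsCrosscap.fixed_compl_body
    (hh : ∀ m, m ∉ ι '' {p | p ∈ punctured ∧ 3 / 8 < ‖p.1‖ ∧ ‖p.1‖ < 1 / 2} → h m = m) {m : M}
    (hm : m ∉ body β ι) : h m = m := by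
  refine hh _ ?_
  rintro ⟨p, hp', rfl⟩
  exact hm (Or.inl ⟨p, ⟨hp'.1, hp'.2.2.le⟩, rfl⟩)

/-- A nontrivial power of the twist around a one-holed Klein bottle is not isotopic to the
identity. -/
theorem IsCrosscap.notMem_H0 [T2Space M] [SigmaCompactSpace M]
    [ChartedSpace (EuclideanHalfSpace 2) M]
    [ConnectedSpace M] (hnc : ¬ CompactSpace M) (hX : IsCrosscap β ι) {n : ℕ} (hn : 0 < n)
    (htw : ∀ z : ℂ, 3 / 8 ≤ ‖z‖ → ‖z‖ ≤ 1 / 2 →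
      h (ι (lineOf z)) = ι (lineOf (rotateBy (fun r => n * twistAngle r) z)))
    (hh : ∀ m, m ∉ ι '' {p | p ∈ punctured ∧ 3 / 8 < ‖p.1‖ ∧ ‖p.1‖ < 1 / 2} → h m = m) :
    h ∉ H0 M := by
  have : LocallyCompactSpace M := ChartedSpace.locallyCompactSpace (EuclideanHalfSpace 2) M
  intro hmem
  obtain ⟨r, hr, hr1, hβ⟩ := hX.exists_radius_disc
  obtain ⟨f, hf, hf1, hfι⟩ := hX.exists_circleMap hnc
  have hfβ : ∀ p ∈ blowup, ‖p.1‖ ≤ r → f (β p) = 1 := fun p hp hpr =>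
    hX.circleMap_eq_one hf hfι hr hr1 hβ hp hpr
  obtain ⟨s, hL, hs, hpos, hneg, hfib⟩ := exists_lineField hX.contB hX.injB hr hr1 hf hf1 hfβ
  obtain ⟨ν, δ, hg⟩ := exists_isLift_of_mem_H0 hL hmem
  have hν : ∀ m ∉ β '' core, ν (m, s m) = s (h m) := fun m hm =>
    hg.nu_section hnc hL (isCompact_core.image_of_continuousOn (hX.contB.mono fun p hp => hp.1))
      (isPreconnected_compl_core hX.contB hX.injB) hs
      (fun m hm hm' => hm (by rwa [h.injective (hX.fixed_core hh hm')] at hm')) hm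
  have hbody : ∀ m, m ∉ body β ι → m ∉ β '' core := fun m hm hm' => hm (Or.inr hm')
  have hD := hX.delta_twist hL hfι hs htw hg hν fun m hm =>
    hg.delta_section_eq_zero hnc hL hX.isCompact_body hX.isPreconnected_compl_body
      (hs.mono hbody)
        (fun m hm => hν m (hbody m hm)) (fun m hm => IsCrosscap.fixed_compl_body hh hm) hm
  have hdisc : ∀ z : ℂ, z ≠ 1 / 4 → ‖z - 1 / 4‖ ≤ 1 / 8 →
      δ (ι (lineOf z), s (ι (lineOf z))) = 4 * Real.pi * n * I := fun z hz' hz => by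
    have hmem : ∀ z ∈ {z : ℂ | ‖z - 1 / 4‖ ∈ Ioc 0 (1 / 8)}, z ≠ 1 / 4 ∧ ‖z - 1 / 4‖ ≤ 1 / 8 :=
      fun z hz => ⟨sub_ne_zero.1 (norm_pos_iff.1 hz.1), hz.2⟩
    rw [← hD]
    refine eq_of_exp_eq_on (L := fun z => δ (ι (lineOf z), s (ι (lineOf z)))) (c := 1)
      (isPreconnected_norm_mem (S := Ioc 0 (1 / 8)) ordConnected_Ioc
        (fun r hr => hr.1.le) (1 / 4)) ?_ ?_
      ⟨norm_pos_iff.2 (sub_ne_zero.2 hz'), hz⟩ (by norm_num)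
    · refine (continuousOn_section hg.cont_delta hs).comp (hX.cont.comp (continuousOn_lineOf.mono
        fun z hz => ne_zero_of_mem_disc (hmem z hz).2) fun z hz => ?_) fun z hz => ?_
      · exact (lineOf_mem_of_mem_disc (hmem z hz).2 (hmem z hz).1).1
      · exact hX.notMem_core _ (lineOf_mem_of_mem_disc (hmem z hz).2 (hmem z hz).1).1
    · intro z hz
      refine exp_delta_eq_one hL hg (hν _ (hX.notMem_core _ ?_)) ?_
      · exact (lineOf_mem_of_mem_disc (hmem z hz).2 (hmem z hz).1).1
      · rw [hX.fixed_disc hh (hmem z hz).2 (hmem z hz).1]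
  have hne : ∀ q : ℝ × ℝ, q.2 ≠ 0 → (polar q).1 ≠ 0 := fun q hq => by
    rwa [← norm_ne_zero_iff, norm_polar_fst, ne_eq, abs_eq_zero]
  have hδ : ∀ q : ℝ × ℝ, |q.2| ≤ r → q.2 ≠ 0 →
      δ (β (polar q), s (β (polar q))) = 4 * Real.pi * n * I := fun q hq h0 => by
    obtain ⟨z, hz', hz, hzq⟩ := hβ _ (polar_mem (hq.trans hr1)) (by rwa [norm_polar_fst]) (hne q h0)
    rw [← hzq, hdisc z hz' hz]
  have hfix : ∀ q : ℝ × ℝ, |q.2| ≤ r → h (β (polar q)) = β (polar q) := fun q hq => by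
    have hp := polar_mem (hq.trans hr1)
    by_cases h0 : (polar q).1 = 0
    · exact hX.fixed_core hh ⟨_, ⟨hp, h0⟩, rfl⟩
    · obtain ⟨z, hz', hz, hzq⟩ := hβ _ hp (by rwa [norm_polar_fst]) h0
      rw [← hzq, hX.fixed_disc hh hz hz']
  let c : ℝ → M × WithLp 2 (ℂ × ℝ) := fun t => (β (polar (0, t)), frame r (0, t))
  have hc : ∀ t ∈ Icc (-r) r, c t ∈ fibre s := fun t ht => hfib (0, t) ((abs_le.2 ht).trans hr1)
  have hcc : ContinuousOn c (Icc (-r) r) := by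
    refine ContinuousOn.prodMk (hX.contB.comp (continuous_polar.comp (by fun_prop)).continuousOn
      fun t ht => polar_mem ((abs_le.2 ht).trans hr1)) ?_
    exact ((continuous_frame r).comp (by fun_prop)).continuousOn
  have key : δ (c (-r)) = δ (c r) := by
    refine eq_of_exp_eq_on (L := fun t => δ (c t)) (c := 1) isPreconnected_Icc
      (hg.cont_delta.comp hcc hc) (fun t ht => ?_) (left_mem_Icc.2 (by linarith))
      (right_mem_Icc.2 (by linarith))
    have h1 := hg.exp_delta _ (hc t ht)
    have h2 : f (β (polar (0, t))) = 1 := by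
      refine hfβ _ (polar_mem ((abs_le.2 ht).trans hr1)) ?_
      rw [norm_polar_fst]; exact abs_le.2 ht
    simp only [c] at h1
    rwa [hfix (0, t) (abs_le.2 ht), h2, conjBy_self_one, conjBy_self_one, one_mul, eq_comm] at h1
  have h1 : δ (c r) = 4 * Real.pi * n * I := by
    simp only [c]
    rw [← hpos (0, r) hr hr1]
    exact hδ (0, r) (abs_of_pos hr).le hr.ne'
  have h2 : δ (c (-r)) = -(4 * Real.pi * n * I) := by
    simp only [c]
    rw [← neg_neg (frame r (0, -r)), ← hneg (0, -r) (neg_neg_iff_pos.2 hr) (neg_le_neg hr1),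
      hg.delta_neg _ _ (mem_fibre_self s _), hδ (0, -r) (by rw [abs_neg, abs_of_pos hr])
        (neg_ne_zero.2 hr.ne')]
  rw [h1, h2, neg_eq_self] at key
  have hn' : (n : ℂ) ≠ 0 := Nat.cast_ne_zero.2 hn.ne'
  have hpi : (Real.pi : ℂ) ≠ 0 := ofReal_ne_zero.2 Real.pi_ne_zero
  exact absurd key (by simp [hn'])

end

end

end MobiusMCG

variable (M : Type*) [TopologicalSpace M] [T2Space M] [SigmaCompactSpace M]
  [ChartedSpace (EuclideanHalfSpace 2) M] [ConnectedSpace M]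

/-- If a σ-compact non-compact connected 2-manifold `M` contains two disjoint embedded
Möbius bands, then the mapping class group `𝓜_c(M) = 𝓗_c(M)/𝓗₀(M)` contains an element
of infinite order. -/
theorem mcg_infinite_order_of_two_mobius (hnc : ¬ CompactSpace M)
    (A B : Set M) (hA : Nonempty (↥A ≃ₜ MobiusBand)) (hB : Nonempty (↥B ≃ₜ MobiusBand))
    (hAB : Disjoint A B) :
    ∃ h ∈ Hc M, ∀ n : ℕ, 0 < n → hpow h n ∉ H0 M := by
  obtain ⟨β, ι, hX⟩ := MobiusMCG.exists_isCrosscap hA hB hAB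
  obtain ⟨h, hc, hh⟩ := hX.exists_twist
  exact ⟨h, hc, fun n hn => hX.notMem_H0 hnc hn (hh n).1 (hh n).2⟩

end
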